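/- Let n ≥ 3, 0 < α < 1 and ζ > 2. Let a_{ij} : ℝⁿ → ℝ (1 ≤ i,j ≤ n) be symmetric coefficients (a_{ij} = a_{ji}) such that: (i) there are 0 < λ ≤ Λ with λ|ξ|² ≤ Σ_{i,j} a_{ij}(x) ξᵢξⱼ ≤ Λ|ξ|² for all x, ξ ∈ ℝⁿ; (ii) each a_{ij} has finite global α-Hölder seminorm [a_{ij}]_{C^α(ℝⁿ)} < ∞; (iii) there exist a symmetric positive definite matrix (a_{ij}(∞)) and constants ε₀, C₀ > 0 with |a_{ij}(x) − a_{ij}(∞)| ≤ C₀|x|^{−ε₀} for all x ≠ 0. Let f : ℝⁿ → ℝ be continuous with limsup_{|x|→∞} |x|^ζ |f(x)| < ∞, and let v ∈ C²(ℝⁿ) satisfy Σ_{i,j} a_{ij}(x) ∂ᵢ∂ⱼ v(x) = f(x) for all x ∈ ℝⁿ and be bounded from above or bounded from below on ℝⁿ. Then there exists a constant v_∞ ∈ ℝ such that v(x) = v_∞ + O(|x|^{2−min{n,ζ}}) as |x| → ∞ if ζ ≠ n, and v(x) = v_∞ + O(|x|^{2−n} ln|x|) if ζ = n. -/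

import Mathlib

open Filter

/-- The Hessian matrix `(∂ᵢ∂ⱼ v(x))` of a function on Euclidean space. -/
noncomputable def hess {n : ℕ} (v : EuclideanSpace ℝ (Fin n) → ℝ)
    (x : EuclideanSpace ℝ (Fin n)) : Matrix (Fin n) (Fin n) ℝ :=
  Matrix.of fun i j =>
    iteratedFDeriv ℝ 2 v x ![EuclideanSpace.single i 1, EuclideanSpace.single j 1]

open Topology

def HasD2 (g : ℝ → ℝ) (c : ℝ) : Prop :=
  ∃ g1 : ℝ → ℝ, (∀ᶠ t in 𝓝 (0:ℝ), HasDerivAt g (g1 t) t) ∧ HasDerivAt g1 c 0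

lemma HasD2.add {g h : ℝ → ℝ} {c d : ℝ} (hg : HasD2 g c) (hh : HasD2 h d) :
    HasD2 (fun t => g t + h t) (c + d) := by
  obtain ⟨g1, hg1, hg2⟩ := hg
  obtain ⟨h1, hh1, hh2⟩ := hh
  refine ⟨fun t => g1 t + h1 t, ?_, hg2.add hh2⟩
  filter_upwards [hg1, hh1] with t a b using a.add b

lemma HasD2.const_mul {g : ℝ → ℝ} {c : ℝ} (k : ℝ) (hg : HasD2 g c) :
    HasD2 (fun t => k * g t) (k * c) := by
  obtain ⟨g1, hg1, hg2⟩ := hg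
  refine ⟨fun t => k * g1 t, ?_, hg2.const_mul k⟩
  filter_upwards [hg1] with t a using a.const_mul k

lemma HasD2.sub {g h : ℝ → ℝ} {c d : ℝ} (hg : HasD2 g c) (hh : HasD2 h d) :
    HasD2 (fun t => g t - h t) (c - d) := by
  have := hg.add (hh.const_mul (-1))
  simpa [sub_eq_add_neg] using this

lemma HasD2.nonpos {g : ℝ → ℝ} {c : ℝ} (hg : HasD2 g c) (hm : IsLocalMax g 0) : c ≤ 0 := by
  obtain ⟨g1, hg1, hg2⟩ := hg
  by_contra hc
  push Not at hc
  have hd : deriv g =ᶠ[𝓝 0] g1 := by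
    filter_upwards [hg1] with t ht using ht.deriv
  have h0 : deriv g 0 = 0 := hm.deriv_eq_zero
  have hdd : deriv (deriv g) 0 = c := by
    rw [hd.deriv_eq]; exact hg2.deriv
  have hmin : IsLocalMin g 0 :=
    isLocalMin_of_deriv_deriv_pos (by rw [hdd]; exact hc) h0 hg1.self_of_nhds.continuousAt
  have hconst : g =ᶠ[𝓝 0] fun _ => g 0 := by
    filter_upwards [hm, hmin] with t a b using le_antisymm a b
  have h1 : deriv g =ᶠ[𝓝 0] deriv (fun _ => g 0) := hconst.deriv
  have : deriv (deriv g) 0 = 0 := by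
    rw [h1.deriv_eq]; simp
  linarith

section basics
variable {n : ℕ}

noncomputable def QF (H : Matrix (Fin n) (Fin n) ℝ) (p : EuclideanSpace ℝ (Fin n)) : ℝ :=
  ∑ i, ∑ j, H i j * p i * p j

noncomputable def tr2 (a H : Matrix (Fin n) (Fin n) ℝ) : ℝ := ∑ i, ∑ j, a i j * H i j

lemma QF_add (G H : Matrix (Fin n) (Fin n) ℝ) (p : EuclideanSpace ℝ (Fin n)) :
    QF (G + H) p = QF G p + QF H p := by
  simp only [QF, Matrix.add_apply, add_mul, Finset.sum_add_distrib]

lemma QF_smul (k : ℝ) (H : Matrix (Fin n) (Fin n) ℝ) (p : EuclideanSpace ℝ (Fin n)) :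
    QF (k • H) p = k * QF H p := by
  simp only [QF, Matrix.smul_apply, smul_eq_mul, Finset.mul_sum, mul_assoc]

lemma QF_sub (G H : Matrix (Fin n) (Fin n) ℝ) (p : EuclideanSpace ℝ (Fin n)) :
    QF (G - H) p = QF G p - QF H p := by
  simp only [QF, Matrix.sub_apply, sub_mul, Finset.sum_sub_distrib]

lemma QF_neg_vec (H : Matrix (Fin n) (Fin n) ℝ) (p : EuclideanSpace ℝ (Fin n)) :
    QF H (-p) = QF H p := by
  simp [QF]

lemma QF_smul_vec (k : ℝ) (H : Matrix (Fin n) (Fin n) ℝ) (p : EuclideanSpace ℝ (Fin n)) :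
    QF H (k • p) = k ^ 2 * QF H p := by
  simp only [QF, Finset.mul_sum, PiLp.smul_apply, smul_eq_mul]
  refine Finset.sum_congr rfl fun i _ => Finset.sum_congr rfl fun j _ => by ring

lemma QF_one (p : EuclideanSpace ℝ (Fin n)) : QF 1 p = ‖p‖ ^ 2 := by
  rw [EuclideanSpace.norm_sq_eq]
  simp [QF, Matrix.one_apply, pow_two]

noncomputable def vv (z : EuclideanSpace ℝ (Fin n)) : Matrix (Fin n) (Fin n) ℝ :=
  Matrix.of fun i j => z i * z j

lemma QF_vv (z p : EuclideanSpace ℝ (Fin n)) : QF (vv z) p = (inner ℝ z p) ^ 2 := by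
  simp only [QF, vv, Matrix.of_apply, PiLp.inner_apply, RCLike.inner_apply, conj_trivial, pow_two,
    Finset.sum_mul_sum]
  refine Finset.sum_congr rfl fun i _ => Finset.sum_congr rfl fun j _ => by ring

lemma tr2_add_left (a b H : Matrix (Fin n) (Fin n) ℝ) : tr2 (a + b) H = tr2 a H + tr2 b H := by
  simp only [tr2, Matrix.add_apply, add_mul, Finset.sum_add_distrib]
lemma tr2_sub_left (a b H : Matrix (Fin n) (Fin n) ℝ) : tr2 (a - b) H = tr2 a H - tr2 b H := by
  simp only [tr2, Matrix.sub_apply, sub_mul, Finset.sum_sub_distrib]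
lemma tr2_smul_left (k : ℝ) (a H : Matrix (Fin n) (Fin n) ℝ) : tr2 (k • a) H = k * tr2 a H := by
  simp only [tr2, Matrix.smul_apply, smul_eq_mul, Finset.mul_sum, mul_assoc]
lemma tr2_comm (a H : Matrix (Fin n) (Fin n) ℝ) : tr2 a H = tr2 H a := by
  simp only [tr2, mul_comm]
lemma tr2_add (a G H : Matrix (Fin n) (Fin n) ℝ) : tr2 a (G + H) = tr2 a G + tr2 a H := by
  simp only [tr2_comm a, tr2_add_left]
lemma tr2_sub (a G H : Matrix (Fin n) (Fin n) ℝ) : tr2 a (G - H) = tr2 a G - tr2 a H := by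
  simp only [tr2_comm a, tr2_sub_left]
lemma tr2_smul (k : ℝ) (a H : Matrix (Fin n) (Fin n) ℝ) : tr2 a (k • H) = k * tr2 a H := by
  simp only [tr2_comm a, tr2_smul_left]
lemma tr2_vv (a : Matrix (Fin n) (Fin n) ℝ) (z : EuclideanSpace ℝ (Fin n)) :
    tr2 a (vv z) = QF a z := by
  simp only [tr2, QF, vv, Matrix.of_apply, mul_assoc]
lemma tr2_one (a : Matrix (Fin n) (Fin n) ℝ) : tr2 a 1 = a.trace := by
  simp [tr2, Matrix.one_apply, Matrix.trace]

lemma trace_eq_QF (a : Matrix (Fin n) (Fin n) ℝ) :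
    a.trace = ∑ i, QF a (EuclideanSpace.single i 1) := by
  simp [Matrix.trace, QF, Pi.single_apply]

lemma trace_le {a : Matrix (Fin n) (Fin n) ℝ} {M : ℝ} (h : ∀ p, QF a p ≤ M * ‖p‖ ^ 2) :
    a.trace ≤ n * M := by
  rw [trace_eq_QF]
  calc _ ≤ ∑ i : Fin n, M := Finset.sum_le_sum fun i _ => by
        simpa using h (EuclideanSpace.single i 1)
    _ = _ := by simp

lemma le_trace {a : Matrix (Fin n) (Fin n) ℝ} {M : ℝ} (h : ∀ p, M * ‖p‖ ^ 2 ≤ QF a p) :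
    n * M ≤ a.trace := by
  rw [trace_eq_QF]
  calc _ = ∑ i : Fin n, M := by simp
    _ ≤ _ := Finset.sum_le_sum fun i _ => by
        simpa using h (EuclideanSpace.single i 1)

open scoped MatrixOrder Matrix.Norms.L2Operator in
lemma tr2_nonpos {a H : Matrix (Fin n) (Fin n) ℝ} (hs : a.IsSymm) (ha : ∀ p, 0 ≤ QF a p)
    (hH : ∀ p, QF H p ≤ 0) : tr2 a H ≤ 0 := by
  have hs' : a.IsHermitian := by
    rw [Matrix.IsHermitian, Matrix.conjTranspose_eq_transpose_of_trivial]; exact hs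
  have hp : a.PosSemidef := by
    refine Matrix.PosSemidef.of_dotProduct_mulVec_nonneg hs' fun x => ?_
    have := ha (WithLp.toLp 2 x)
    simp only [QF] at this
    simpa [dotProduct, Matrix.mulVec, Finset.mul_sum, mul_comm, mul_assoc, mul_left_comm] using this
  obtain ⟨B, hB⟩ := CStarAlgebra.nonneg_iff_eq_star_mul_self.mp hp.nonneg
  have : tr2 a H = ∑ k, QF H (WithLp.toLp 2 (B k)) := by
    simp only [tr2, QF, hB, Matrix.star_eq_conjTranspose, Matrix.mul_apply, Matrix.conjTranspose_apply, star_trivial, Finset.sum_mul]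
    rw [Finset.sum_comm_cycle]
    refine Finset.sum_congr rfl fun k _ => Finset.sum_congr rfl fun i _ =>
      Finset.sum_congr rfl fun j _ => by ring
  rw [this]
  exact Finset.sum_nonpos fun k _ => hH _

def HasH (g : EuclideanSpace ℝ (Fin n) → ℝ) (x : EuclideanSpace ℝ (Fin n))
    (H : Matrix (Fin n) (Fin n) ℝ) : Prop :=
  ∀ p : EuclideanSpace ℝ (Fin n), HasD2 (fun t : ℝ => g (x + t • p)) (QF H p)

lemma HasH.add {g h : EuclideanSpace ℝ (Fin n) → ℝ} {x : EuclideanSpace ℝ (Fin n)}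
    {G H : Matrix (Fin n) (Fin n) ℝ} (hg : HasH g x G) (hh : HasH h x H) :
    HasH (fun y => g y + h y) x (G + H) := fun p => by
  rw [QF_add]; exact (hg p).add (hh p)

lemma HasH.sub {g h : EuclideanSpace ℝ (Fin n) → ℝ} {x : EuclideanSpace ℝ (Fin n)}
    {G H : Matrix (Fin n) (Fin n) ℝ} (hg : HasH g x G) (hh : HasH h x H) :
    HasH (fun y => g y - h y) x (G - H) := fun p => by
  rw [QF_sub]; exact (hg p).sub (hh p)

lemma HasH.const_mul {g : EuclideanSpace ℝ (Fin n) → ℝ} {x : EuclideanSpace ℝ (Fin n)}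
    {G : Matrix (Fin n) (Fin n) ℝ} (k : ℝ) (hg : HasH g x G) :
    HasH (fun y => k * g y) x (k • G) := fun p => by
  rw [QF_smul]; exact (hg p).const_mul k

lemma HasH.tr2_nonpos {g : EuclideanSpace ℝ (Fin n) → ℝ} {x : EuclideanSpace ℝ (Fin n)}
    {G a : Matrix (Fin n) (Fin n) ℝ} (hg : HasH g x G) (hm : IsLocalMax g x)
    (hs : a.IsSymm) (ha : ∀ p, 0 ≤ QF a p) : tr2 a G ≤ 0 := by
  refine _root_.tr2_nonpos hs ha fun p => (hg p).nonpos ?_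
  have hc : ContinuousAt (fun t : ℝ => x + t • p) 0 := by fun_prop
  have hm' : IsLocalMax g (x + (0:ℝ) • p) := by simpa using hm
  exact IsMaxFilter.comp_tendsto (g := fun t : ℝ => x + t • p) hm' hc

lemma hasH_hess {v : EuclideanSpace ℝ (Fin n) → ℝ} (hv : ContDiff ℝ 2 v)
    (x : EuclideanSpace ℝ (Fin n)) : HasH v x (hess v x) := by
  intro p
  have hv1 : Differentiable ℝ v := hv.differentiable (by norm_num)
  have hv2 : Differentiable ℝ (fderiv ℝ v) :=
    (hv.fderiv_right (m := 1) (by norm_num)).differentiable (by norm_num)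
  have hl : ∀ t : ℝ, HasDerivAt (fun t : ℝ => x + t • p) p t := fun t => by
    simpa using ((hasDerivAt_id t).smul_const p).const_add x
  have hq : QF (hess v x) p = fderiv ℝ (fderiv ℝ v) x p p := by
    have hp : p = ∑ i, p i • EuclideanSpace.single i (1:ℝ) := by
      ext j; simp [Pi.single_apply]
    conv_rhs => rw [hp]
    simp only [map_sum, map_smul, sum_apply, smul_apply,
      smul_eq_mul, QF, hess, Matrix.of_apply, iteratedFDeriv_two_apply]
    simp only [Finset.mul_sum]
    rw [Finset.sum_comm]
    refine Finset.sum_congr rfl fun i _ => Finset.sum_congr rfl fun j _ => ?_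
    simp
    ring
  refine ⟨fun t => fderiv ℝ v (x + t • p) p, Eventually.of_forall fun t => ?_, ?_⟩
  · exact (hv1 _).hasFDerivAt.comp_hasDerivAt t (hl t)
  · rw [hq]
    have h1 := (hv2 (x + (0:ℝ) • p)).hasFDerivAt.comp_hasDerivAt (0:ℝ) (hl 0)
    simp only [zero_smul, add_zero] at h1
    exact (ContinuousLinearMap.apply ℝ ℝ p).hasFDerivAt.comp_hasDerivAt (0:ℝ) h1

lemma hasH_radial {F F1 : ℝ → ℝ} {F2 : ℝ} {x x0 : EuclideanSpace ℝ (Fin n)}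
    (h1 : ∀ᶠ s in 𝓝 (‖x - x0‖ ^ 2), HasDerivAt F (F1 s) s)
    (h2 : HasDerivAt F1 F2 (‖x - x0‖ ^ 2)) :
    HasH (fun y => F (‖y - x0‖ ^ 2)) x
      ((2 * F1 (‖x - x0‖ ^ 2)) • (1 : Matrix (Fin n) (Fin n) ℝ) + (4 * F2) • vv (x - x0)) := by
  intro p
  rw [QF_add, QF_smul, QF_smul, QF_one, QF_vv]
  set z := x - x0
  let s : ℝ → ℝ := fun t => ‖z‖ ^ 2 + t * (2 * inner ℝ z p) + t ^ 2 * ‖p‖ ^ 2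
  have hs : ∀ t : ℝ, ‖x + t • p - x0‖ ^ 2 = s t := fun t => by
    have : x + t • p - x0 = z + t • p := by simp only [z]; abel
    rw [this, norm_add_sq_real, inner_smul_right, norm_smul, mul_pow, Real.norm_eq_abs, sq_abs]
    simp only [s]; ring
  have hs0 : s 0 = ‖z‖ ^ 2 := by simp [s]
  let s1 : ℝ → ℝ := fun t => 2 * inner ℝ z p + 2 * t * ‖p‖ ^ 2
  have hs1 : ∀ t, HasDerivAt s (s1 t) t := fun t => by
    have := (((hasDerivAt_id t).mul_const (2 * inner ℝ z p)).const_add (‖z‖ ^ 2)).add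
      (((hasDerivAt_id t).pow 2).mul_const (‖p‖ ^ 2))
    exact this.congr_deriv (by simp [s1])
  have hs2 : HasDerivAt s1 (2 * ‖p‖ ^ 2) 0 := by
    have := (((hasDerivAt_id (0:ℝ)).const_mul 2).mul_const (‖p‖ ^ 2)).const_add (2 * inner ℝ z p)
    exact this.congr_deriv (by simp)
  simp only [hs]
  refine ⟨fun t => F1 (s t) * s1 t, ?_, ?_⟩
  · have hc : Tendsto s (𝓝 0) (𝓝 (‖z‖ ^ 2)) := by
      have := (hs1 0).continuousAt.tendsto
      rwa [hs0] at this
    filter_upwards [hc.eventually h1] with t ht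
    exact ht.comp t (hs1 t)
  · have h2' : HasDerivAt F1 F2 (s 0) := by rw [hs0]; exact h2
    have := (h2'.comp 0 (hs1 0)).mul hs2
    exact this.congr_deriv (by simp [s1, hs0]; ring)

lemma hasH_pow {K q : ℝ} {x x0 : EuclideanSpace ℝ (Fin n)} (h : 0 < K + ‖x - x0‖ ^ 2) :
    HasH (fun y => (K + ‖y - x0‖ ^ 2) ^ q) x
      ((2 * (q * (K + ‖x - x0‖ ^ 2) ^ (q - 1))) • (1 : Matrix (Fin n) (Fin n) ℝ)
        + (4 * (q * (q - 1) * (K + ‖x - x0‖ ^ 2) ^ (q - 2))) • vv (x - x0)) := by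
  have hd : ∀ (r s : ℝ), 0 < K + s → HasDerivAt (fun s => (K + s) ^ r) (r * (K + s) ^ (r - 1)) s := by
    intro r s hs
    have := ((hasDerivAt_id s).const_add K).rpow_const (p := r) (Or.inl hs.ne')
    simpa using this
  refine hasH_radial (F := fun s => (K + s) ^ q) (F1 := fun s => q * (K + s) ^ (q - 1)) ?_ ?_
  · have : ∀ᶠ s in 𝓝 (‖x - x0‖ ^ 2), 0 < K + s :=
      (continuous_const.add continuous_id).continuousAt.eventually (lt_mem_nhds h)
    filter_upwards [this] with s hs using hd q s hs
  · have := (hd (q - 1) _ h).const_mul q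
    exact this.congr_deriv (by rw [show q - 1 - 1 = q - 2 by ring]; ring)

end basics

section doubling
variable {n : ℕ}

lemma tr2_pow (a : Matrix (Fin n) (Fin n) ℝ) (c d : ℝ) (z : EuclideanSpace ℝ (Fin n)) :
    tr2 a (c • (1 : Matrix (Fin n) (Fin n) ℝ) + d • vv z) = c * a.trace + d * QF a z := by
  rw [tr2_add, tr2_smul, tr2_smul, tr2_one, tr2_vv]

lemma vv_symm (z : EuclideanSpace ℝ (Fin n)) : (vv z).IsSymm := by
  ext i j; simp [vv, mul_comm]

lemma doubling {η A : ℝ} (hη0 : 0 ≤ η) (hη : 8 * n * η ≤ 1) (hn : 1 ≤ n) (hA : 0 ≤ A)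
    {ax ay X Y G1 G2 : Matrix (Fin n) (Fin n) ℝ}
    (hsx : ax.IsSymm) (hsy : ay.IsSymm)
    (hx1 : ∀ p, (1 - η) * ‖p‖ ^ 2 ≤ QF ax p) (hx2 : ∀ p, QF ax p ≤ (1 + η) * ‖p‖ ^ 2)
    (hy1 : ∀ p, (1 - η) * ‖p‖ ^ 2 ≤ QF ay p) (hy2 : ∀ p, QF ay p ≤ (1 + η) * ‖p‖ ^ 2)
    {v g1 g2 : EuclideanSpace ℝ (Fin n) → ℝ} {x y : EuclideanSpace ℝ (Fin n)} (hxy : x ≠ y)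
    (hX : HasH v x X) (hY : HasH v y Y) (hG1 : HasH g1 x G1) (hG2 : HasH g2 y G2)
    (hm : IsLocalMax (fun P : EuclideanSpace ℝ (Fin n) × EuclideanSpace ℝ (Fin n) =>
      v P.1 - v P.2 - A * (‖P.1 - P.2‖ ^ 2) ^ (1 / 4 : ℝ) - g1 P.1 - g2 P.2) (x, y)) :
    tr2 ax X - tr2 ay Y - tr2 ax G1 - tr2 ay G2 ≤ - (A / 4) * (‖x - y‖ ^ 2) ^ (-3 / 4 : ℝ) := by
  set z := x - y with hz
  have hz0 : 0 < ‖z‖ := norm_pos_iff.mpr (sub_ne_zero.mpr hxy)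
  set s := ‖z‖ ^ 2 with hs
  have hs0 : 0 < s := by positivity
  obtain ⟨Z, hZ, hZ'⟩ : ∃ Z : Matrix (Fin n) (Fin n) ℝ,
      HasH (fun w : EuclideanSpace ℝ (Fin n) => (‖w‖ ^ 2) ^ (1 / 4 : ℝ)) z Z ∧
      Z = (1 / 2 * s ^ (-3 / 4 : ℝ)) • (1 : Matrix (Fin n) (Fin n) ℝ) +
        (-3 / 4 * s ^ (-7 / 4 : ℝ)) • vv z := by
    have := hasH_pow (n := n) (K := 0) (q := 1 / 4) (x := z) (x0 := 0) (by simpa using hs0)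
    simp only [zero_add, sub_zero] at this
    refine ⟨_, this, ?_⟩
    rw [← hs]
    congr 2
    · norm_num; ring
    · norm_num; ring
  have star : ∀ p q, QF X p - QF Y q - A * QF Z (p - q) - QF G1 p - QF G2 q ≤ 0 := by
    intro p q
    have h := ((((hX p).sub (hY q)).sub ((hZ (p - q)).const_mul A)).sub (hG1 p)).sub (hG2 q)
    refine h.nonpos ?_
    have hc : ContinuousAt (fun t : ℝ => (x + t • p, y + t • q)) 0 := by fun_prop
    have hm' := hm
    rw [show (x, y) = (fun t : ℝ => (x + t • p, y + t • q)) 0 by simp] at hm'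
    have := IsMaxFilter.comp_tendsto (g := fun t : ℝ => (x + t • p, y + t • q)) hm' hc
    have e : ∀ t : ℝ, z + t • (p - q) = x + t • p - (y + t • q) := fun t => by
      rw [hz, smul_sub]; abel
    simp only [e]
    exact this
  have hone : (1 : Matrix (Fin n) (Fin n) ℝ).IsSymm := by simp [Matrix.IsSymm]
  have hbxs : (ax - (1 - η) • (1 : Matrix (Fin n) (Fin n) ℝ)).IsSymm := hsx.sub (hone.smul _)
  have hbys : (ay - (1 - η) • (1 : Matrix (Fin n) (Fin n) ℝ)).IsSymm := hsy.sub (hone.smul _)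
  have hbx : ∀ p, 0 ≤ QF (ax - (1 - η) • (1 : Matrix (Fin n) (Fin n) ℝ)) p := fun p => by
    rw [QF_sub, QF_smul, QF_one]; linarith [hx1 p]
  have hby : ∀ p, 0 ≤ QF (ay - (1 - η) • (1 : Matrix (Fin n) (Fin n) ℝ)) p := fun p => by
    rw [QF_sub, QF_smul, QF_one]; linarith [hy1 p]
  have hbx2 : (ax - (1 - η) • (1 : Matrix (Fin n) (Fin n) ℝ)).trace ≤ n * (2 * η) :=
    trace_le fun p => by rw [QF_sub, QF_smul, QF_one]; linarith [hx2 p]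
  have hby2 : (ay - (1 - η) • (1 : Matrix (Fin n) (Fin n) ℝ)).trace ≤ n * (2 * η) :=
    trace_le fun p => by rw [QF_sub, QF_smul, QF_one]; linarith [hy2 p]
  have QF0 : ∀ H : Matrix (Fin n) (Fin n) ℝ, QF H 0 = 0 := fun H => by simp [QF]
  have I1 : tr2 (ax - (1 - η) • (1 : Matrix (Fin n) (Fin n) ℝ)) (X - A • Z - G1) ≤ 0 := by
    refine tr2_nonpos hbxs hbx fun p => ?_
    have := star p 0
    simp only [QF0, sub_zero] at this
    rw [QF_sub, QF_sub, QF_smul]; linarith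
  have I2 : tr2 (ay - (1 - η) • (1 : Matrix (Fin n) (Fin n) ℝ)) ((-1 : ℝ) • Y - A • Z - G2) ≤ 0 := by
    refine tr2_nonpos hbys hby fun p => ?_
    have := star 0 p
    simp only [QF0, zero_sub, QF_neg_vec] at this
    rw [QF_sub, QF_sub, QF_smul, QF_smul]; linarith
  have I3 : tr2 ((1 : Matrix (Fin n) (Fin n) ℝ) - s⁻¹ • vv z) (X - Y - G1 - G2) ≤ 0 := by
    refine tr2_nonpos (hone.sub ((vv_symm z).smul _)) (fun p => ?_) fun p => ?_
    · rw [QF_sub, QF_smul, QF_one, QF_vv]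
      have h1 : (inner ℝ z p) ^ 2 ≤ s * ‖p‖ ^ 2 := by
        have := abs_real_inner_le_norm z p
        rw [← sq_abs, hs, ← mul_pow]
        exact pow_le_pow_left₀ (abs_nonneg _) this 2
      have : s⁻¹ * (inner ℝ z p) ^ 2 ≤ s⁻¹ * (s * ‖p‖ ^ 2) :=
        mul_le_mul_of_nonneg_left h1 (by positivity)
      rw [← mul_assoc, inv_mul_cancel₀ hs0.ne', one_mul] at this
      linarith
    · have := star p p
      simp only [sub_self, QF0] at this
      rw [QF_sub, QF_sub, QF_sub]; linarith
  have I4 := star z (-z)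
  rw [sub_neg_eq_add, ← two_smul ℝ z, QF_smul_vec, QF_neg_vec, QF_neg_vec] at I4
  have QFZ : QF Z z = - (1 / 4) * (s * s ^ (-3 / 4 : ℝ)) := by
    rw [hZ', QF_add, QF_smul, QF_smul, QF_one, QF_vv, real_inner_self_eq_norm_sq, ← hs]
    have : s ^ (-3 / 4 : ℝ) = s ^ (-7 / 4 : ℝ) * s := by
      rw [← Real.rpow_add_one hs0.ne']; norm_num
    rw [this]; ring
  have I4' : s⁻¹ * QF X z - s⁻¹ * QF Y z - s⁻¹ * QF G1 z - s⁻¹ * QF G2 z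
      + A * s ^ (-3 / 4 : ℝ) ≤ 0 := by
    have h := mul_le_mul_of_nonneg_left I4 (inv_pos.mpr hs0).le
    rw [QFZ] at h
    have e : s⁻¹ * (A * (2 ^ 2 * (-(1 / 4) * (s * s ^ (-3 / 4 : ℝ))))) = - (A * s ^ (-3 / 4 : ℝ)) := by
      field_simp
      norm_num
    linarith
  have hS : 0 < s ^ (-3 / 4 : ℝ) := Real.rpow_pos_of_pos hs0 _
  have hS' : 0 < s ^ (-7 / 4 : ℝ) := Real.rpow_pos_of_pos hs0 _
  have T : ∀ b : Matrix (Fin n) (Fin n) ℝ, (∀ p, 0 ≤ QF b p) → b.trace ≤ n * (2 * η) →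
      A * tr2 b Z ≤ A * (1 / 8 * s ^ (-3 / 4 : ℝ)) := by
    intro b hb hb2
    refine mul_le_mul_of_nonneg_left ?_ hA
    rw [hZ', tr2_pow]
    nlinarith [mul_nonneg hS'.le (hb z)]
  have T1 := T _ hbx hbx2
  have T2 := T _ hby hby2
  have J := add_nonpos I3 I4'
  have hn' : (1:ℝ) ≤ n := by exact_mod_cast hn
  have hη8 : η ≤ 1 / 8 := by nlinarith
  have J' := mul_le_mul_of_nonneg_left J (show 0 ≤ 1 - η by linarith)
  simp only [tr2_sub, tr2_sub_left, tr2_smul, tr2_smul_left, tr2_comm (vv z), tr2_vv] at I1 I2 J' T1 T2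
  nlinarith [mul_nonneg hA hS.le, mul_nonneg (mul_nonneg hA hS.le) (sub_nonneg.mpr hη8)]

end doubling

section barrier

structure CoreHyp (n : ℕ) (ζ ε C lam Lam Cf Rf : ℝ)
    (a : EuclideanSpace ℝ (Fin n) → Matrix (Fin n) (Fin n) ℝ)
    (f v : EuclideanSpace ℝ (Fin n) → ℝ) : Prop where
  hn : 3 ≤ n
  hζ : 2 < ζ
  hε : 0 < ε
  hC : 0 < C
  hlam : 0 < lam
  hLam : 0 < Lam
  hCf : 0 < Cf
  hRf : 0 < Rf
  symm : ∀ x, (a x).IsSymm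
  lo : ∀ x p, lam * ‖p‖ ^ 2 ≤ QF (a x) p
  hi : ∀ x p, QF (a x) p ≤ Lam * ‖p‖ ^ 2
  near : ∀ x, x ≠ 0 → ∀ p, |QF (a x) p - ‖p‖ ^ 2| ≤ C * ‖x‖ ^ (-ε) * ‖p‖ ^ 2
  fcont : Continuous f
  fdecay : ∀ x, Rf ≤ ‖x‖ → ‖x‖ ^ ζ * |f x| ≤ Cf
  hv : ContDiff ℝ 2 v
  heq : ∀ x, tr2 (a x) (hess v x) = f x

variable {n : ℕ} {ζ ε C lam Lam Cf Rf : ℝ}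
  {a : EuclideanSpace ℝ (Fin n) → Matrix (Fin n) (Fin n) ℝ}
  {f v : EuclideanSpace ℝ (Fin n) → ℝ}

lemma CoreHyp.pos (h : CoreHyp n ζ ε C lam Lam Cf Rf a f v) (x p) : 0 ≤ QF (a x) p :=
  le_trans (mul_nonneg h.hlam.le (by positivity)) (h.lo x p)

lemma CoreHyp.eta (h : CoreHyp n ζ ε C lam Lam Cf Rf a f v) {η : ℝ} (hη : 0 < η) :
    ∃ R : ℝ, 1 ≤ R ∧ ∀ x : EuclideanSpace ℝ (Fin n), R ≤ ‖x‖ →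
      (∀ p, (1 - η) * ‖p‖ ^ 2 ≤ QF (a x) p) ∧ ∀ p, QF (a x) p ≤ (1 + η) * ‖p‖ ^ 2 := by
  have ht : Tendsto (fun r : ℝ => C * r ^ (-ε)) atTop (𝓝 (C * 0)) :=
    (tendsto_rpow_neg_atTop h.hε).const_mul C
  rw [mul_zero] at ht
  obtain ⟨R, hR⟩ := eventually_atTop.mp ((tendsto_order.mp ht).2 η hη)
  refine ⟨max R 1, le_max_right _ _, fun x hx => ?_⟩
  have hx0 : x ≠ 0 := by
    rintro rfl
    have := (le_max_right R 1).trans hx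
    simp at this
    linarith
  have h1 := hR ‖x‖ ((le_max_left _ _).trans hx)
  have h2 : ∀ p, |QF (a x) p - ‖p‖ ^ 2| ≤ η * ‖p‖ ^ 2 := fun p =>
    (h.near x hx0 p).trans (mul_le_mul_of_nonneg_right h1.le (by positivity))
  constructor <;> intro p <;> have := abs_le.mp (h2 p) <;> linarith [this.1, this.2]

lemma CoreHyp.fbound (h : CoreHyp n ζ ε C lam Lam Cf Rf a f v) {K s : ℝ} (hK : 0 ≤ K) (hs : 0 ≤ s)
    (hsz : 2 * s ≤ ζ) :
    ∃ C' : ℝ, ∀ x : EuclideanSpace ℝ (Fin n), |f x| * (K + ‖x‖ ^ 2) ^ s ≤ C' := by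
  obtain ⟨B, hB⟩ := (isCompact_closedBall (0 : EuclideanSpace ℝ (Fin n)) (max Rf 1)).exists_bound_of_continuousOn
    (f := fun x => |f x| * (K + ‖x‖ ^ 2) ^ s) (by
      apply Continuous.continuousOn
      exact h.fcont.abs.mul ((continuous_const.add (continuous_norm.pow 2)).rpow_const
        fun x => Or.inr hs))
  refine ⟨max B ((K + 1) ^ s * Cf), fun x => ?_⟩
  rcases le_total ‖x‖ (max Rf 1) with hx | hx
  · have := hB x (by simpa using hx)
    exact ((le_abs_self _).trans this).trans (le_max_left _ _)
  · refine le_trans ?_ (le_max_right _ _)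
    have h1 : 1 ≤ ‖x‖ := (le_max_right _ _).trans hx
    have h2 := h.fdecay x ((le_max_left _ _).trans hx)
    have h3 : (K + ‖x‖ ^ 2) ^ s ≤ (K + 1) ^ s * ‖x‖ ^ ζ := by
      calc (K + ‖x‖ ^ 2) ^ s ≤ ((K + 1) * ‖x‖ ^ 2) ^ s := by
            apply Real.rpow_le_rpow (by positivity) _ hs
            nlinarith [mul_le_mul_of_nonneg_left (one_le_pow₀ h1 : 1 ≤ ‖x‖ ^ 2) hK]
        _ = (K + 1) ^ s * ‖x‖ ^ (2 * s) := by
            rw [Real.mul_rpow (by positivity) (by positivity), Real.rpow_mul (by positivity)]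
            norm_num
        _ ≤ _ := by
            gcongr
    calc |f x| * (K + ‖x‖ ^ 2) ^ s ≤ |f x| * ((K + 1) ^ s * ‖x‖ ^ ζ) := by gcongr
      _ = (K + 1) ^ s * (‖x‖ ^ ζ * |f x|) := by ring
      _ ≤ _ := by gcongr

lemma CoreHyp.barrier (h : CoreHyp n ζ ε C lam Lam Cf Rf a f v) :
    ∃ (w : EuclideanSpace ℝ (Fin n) → ℝ)
      (W : EuclideanSpace ℝ (Fin n) → Matrix (Fin n) (Fin n) ℝ) (B : ℝ),
      Continuous w ∧ (∀ x, HasH w x (W x)) ∧ (∀ x, 0 ≤ w x) ∧ (∀ x, w x ≤ B) ∧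
      ∀ x, tr2 (a x) (W x) < - |f x| := by
  have hn : (3:ℝ) ≤ n := by exact_mod_cast h.hn
  have hζ := h.hζ
  have hlam := h.hlam
  have hLam := h.hLam
  set s : ℝ := min ((ζ - 2) / 2) (1 / 4) with hs
  have hs0 : 0 < s := lt_min (by linarith) (by norm_num)
  have hs1 : s ≤ 1 / 4 := min_le_right _ _
  have hs2 : 2 * (s + 1) ≤ ζ := by
    have := min_le_left ((ζ - 2) / 2) (1 / 4); rw [← hs] at this; linarith
  obtain ⟨R0, hR0, hR⟩ := h.eta (η := 1 / (8 * n)) (by positivity)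
  set K : ℝ := 5 * Lam * R0 ^ 2 / lam + 1 with hK
  have hK1 : 1 ≤ K := by rw [hK]; have : 0 ≤ 5 * Lam * R0 ^ 2 / lam := by positivity
                         linarith
  obtain ⟨C', hC'⟩ := h.fbound (K := K) (s := s + 1) (by linarith) (by linarith) hs2
  set c : ℝ := min (1 / 4) lam with hc
  have hc0 : 0 < c := lt_min (by norm_num) hlam
  set N : ℝ := (|C'| + 1) / (2 * s * c) with hN
  have hN0 : 0 < N := by positivity
  have hS : ∀ x : EuclideanSpace ℝ (Fin n), 0 < K + ‖x‖ ^ 2 := fun x => by positivity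
  have key : ∀ x, c * (K + ‖x‖ ^ 2) ≤ (K + ‖x‖ ^ 2) * (a x).trace - 2 * (s + 1) * QF (a x) x := by
    intro x
    have hq0 := h.pos x x
    have hq : 2 * (s + 1) * QF (a x) x ≤ 5 / 2 * QF (a x) x :=
      mul_le_mul_of_nonneg_right (by linarith) hq0
    rcases le_total R0 ‖x‖ with hx | hx
    · obtain ⟨h1, h2⟩ := hR x hx
      have ht := le_trace h1
      have e : (n:ℝ) * (1 - 1 / (8 * n)) = n - 1 / 8 := by field_simp
      rw [e] at ht
      have e2 : 1 / (8 * (n:ℝ)) ≤ 1 / 24 := by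
        apply one_div_le_one_div_of_le <;> linarith
      have h3 := h2 x
      have h4 : QF (a x) x ≤ 25 / 24 * ‖x‖ ^ 2 := h3.trans (by nlinarith [sq_nonneg ‖x‖])
      have hc4 : c ≤ 1 / 4 := min_le_left _ _
      nlinarith [hS x, sq_nonneg ‖x‖, mul_le_mul_of_nonneg_left ht (hS x).le]
    · have ht := le_trace (h.lo x)
      have h4 := h.hi x x
      have hr : ‖x‖ ^ 2 ≤ R0 ^ 2 := by gcongr
      have h5 : 5 * Lam * R0 ^ 2 ≤ lam * K := by
        rw [hK]; field_simp; nlinarith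
      have hcl : c ≤ lam := min_le_right _ _
      nlinarith [hS x, sq_nonneg ‖x‖, mul_le_mul_of_nonneg_left ht (hS x).le,
        mul_le_mul_of_nonneg_left hr hLam.le, mul_le_mul_of_nonneg_left hcl (hS x).le,
        mul_nonneg hlam.le (sq_nonneg ‖x‖), mul_le_mul_of_nonneg_left hn (mul_nonneg hlam.le (hS x).le)]
  refine ⟨fun x => N * (K + ‖x - 0‖ ^ 2) ^ (-s), fun x => N • _, N, ?_, fun x =>
    (hasH_pow (K := K) (q := -s) (x0 := 0) (by simpa using hS x)).const_mul N, fun x => ?_,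
    fun x => ?_, fun x => ?_⟩
  · refine continuous_const.mul ((by fun_prop : Continuous fun x : EuclideanSpace ℝ (Fin n) =>
      K + ‖x - 0‖ ^ 2).rpow_const fun x => Or.inl ?_)
    simpa using (hS x).ne'
  · positivity
  · have : (K + ‖x - 0‖ ^ 2) ^ (-s) ≤ 1 :=
      Real.rpow_le_one_of_one_le_of_nonpos (by nlinarith [sq_nonneg ‖x - 0‖]) (by linarith)
    nlinarith
  · rw [tr2_smul, tr2_pow]
    simp only [sub_zero]
    set S := K + ‖x‖ ^ 2 with hSdef
    have hSx : 0 < S := hS x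
    have e1 : S ^ (-s - 1) = S ^ (-s - 2) * S := by
      rw [← Real.rpow_add_one hSx.ne']; congr 1; ring
    have hp : 0 < S ^ (-s - 2) := Real.rpow_pos_of_pos hSx _
    have hf : |f x| ≤ |C'| * S ^ (-s - 1) := by
      have h1 := (hC' x).trans (le_abs_self _)
      rw [← hSdef] at h1
      have e : S ^ (s + 1) * S ^ (-s - 1) = 1 := by
        rw [← Real.rpow_add hSx]; simp
      calc |f x| = |f x| * S ^ (s + 1) * S ^ (-s - 1) := by rw [mul_assoc, e, mul_one]
        _ ≤ _ := mul_le_mul_of_nonneg_right h1 (Real.rpow_nonneg hSx.le _)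
    have hmain : N * (2 * (-s * S ^ (-s - 1)) * (a x).trace +
        4 * (-s * (-s - 1) * S ^ (-s - 2)) * QF (a x) x)
        = - (2 * s * N * S ^ (-s - 2)) * (S * (a x).trace - 2 * (s + 1) * QF (a x) x) := by
      rw [e1]; ring
    rw [hmain]
    have h2 : (2 * s * N * S ^ (-s - 2)) * (c * S) ≤
      (2 * s * N * S ^ (-s - 2)) * (S * (a x).trace - 2 * (s + 1) * QF (a x) x) :=
      mul_le_mul_of_nonneg_left (key x) (by positivity)
    have h3 : (2 * s * N * S ^ (-s - 2)) * (c * S) = (|C'| + 1) * S ^ (-s - 1) := by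
      rw [e1, hN]; field_simp
    have : 0 < S ^ (-s - 1) := Real.rpow_pos_of_pos hSx _
    linarith

end barrier

section bounded
variable {n : ℕ} {ζ ε C lam Lam Cf Rf : ℝ}
  {a : EuclideanSpace ℝ (Fin n) → Matrix (Fin n) (Fin n) ℝ}
  {f v : EuclideanSpace ℝ (Fin n) → ℝ}

lemma tendsto_norm_sub_sq (x1 : EuclideanSpace ℝ (Fin n)) :
    Tendsto (fun x => ‖x - x1‖ ^ 2) (cocompact (EuclideanSpace ℝ (Fin n))) atTop := by
  refine (tendsto_pow_atTop two_ne_zero).comp ?_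
  refine tendsto_atTop_mono (f := fun x => ‖x‖ + (-‖x1‖)) (fun x => ?_)
    (tendsto_atTop_add_const_right _ _ tendsto_norm_cocompact_atTop)
  have := norm_sub_norm_le x x1
  linarith

lemma rpow_m34 {S : ℝ} (hS : 0 ≤ S) : S ^ (-3 / 4 : ℝ) = ((S ^ (1 / 4 : ℝ)) ^ 3)⁻¹ := by
  rw [← Real.rpow_natCast, ← Real.rpow_mul hS, ← Real.rpow_neg hS]
  norm_num

lemma rpow_14 {S : ℝ} (hS : 0 ≤ S) : (S ^ (1 / 4 : ℝ)) ^ 4 = S := by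
  rw [← Real.rpow_natCast, ← Real.rpow_mul hS]
  norm_num

lemma CoreHyp.lower (h : CoreHyp n ζ ε C lam Lam Cf Rf a f v)
    {w : EuclideanSpace ℝ (Fin n) → ℝ}
    {W : EuclideanSpace ℝ (Fin n) → Matrix (Fin n) (Fin n) ℝ}
    (hwc : Continuous w) (hwH : ∀ x, HasH w x (W x)) (hw0 : ∀ x, 0 ≤ w x)
    (hwL : ∀ x, tr2 (a x) (W x) < - |f x|) (hv0 : ∀ x, 0 ≤ v x) {q : ℝ} (hq : 0 < q)
    (hq2 : n * Lam ≤ 2 * (q + 1) * lam)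
    {x1 : EuclideanSpace ℝ (Fin n)} {ρ H : ℝ} (hρ : 0 < ρ) (hH : 0 ≤ H)
    (hvH : ∀ y, ‖y - x1‖ ≤ ρ → H ≤ v y) (x : EuclideanSpace ℝ (Fin n)) (hx : ρ ≤ ‖x - x1‖) :
    H * (ρ ^ 2) ^ q * (‖x - x1‖ ^ 2) ^ (-q) ≤ v x + w x := by
  by_contra hcon
  push Not at hcon
  set k := H * (ρ ^ 2) ^ q with hk
  have hk0 : 0 ≤ k := by positivity
  set T : Set (EuclideanSpace ℝ (Fin n)) := {y | ρ ≤ ‖y - x1‖} with hT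
  have hTc : IsClosed T := isClosed_le continuous_const (by fun_prop)
  set D : EuclideanSpace ℝ (Fin n) → ℝ :=
    fun y => k * (0 + ‖y - x1‖ ^ 2) ^ (-q) - (v y + w y) with hD
  have hvc : Continuous v := h.hv.continuous
  have hDc : ContinuousOn D T := by
    refine ContinuousOn.sub (continuousOn_const.mul ?_) (hvc.add hwc).continuousOn
    refine ContinuousOn.rpow_const (by fun_prop) fun y hy => Or.inl ?_
    have : 0 < ‖y - x1‖ := lt_of_lt_of_le hρ hy
    positivity
  have hDx : 0 < D x := by simp only [hD, zero_add]; linarith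
  have hlim : Tendsto (fun y => k * (0 + ‖y - x1‖ ^ 2) ^ (-q))
      (cocompact (EuclideanSpace ℝ (Fin n))) (𝓝 (k * 0)) := by
    simp only [zero_add]
    exact ((tendsto_rpow_neg_atTop hq).comp (tendsto_norm_sub_sq x1)).const_mul k
  rw [mul_zero] at hlim
  obtain ⟨xm, hxm, hmax⟩ := hDc.exists_isMaxOn' hTc (x₀ := x) hx (by
    apply Filter.Eventually.filter_mono inf_le_left
    filter_upwards [(tendsto_order.mp hlim).2 _ hDx] with y hy
    simp only [hD] at hy ⊢
    linarith [hv0 y, hw0 y])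
  have hDm : 0 < D xm := hDx.trans_le (hmax hx)
  have hlt : ρ < ‖xm - x1‖ := by
    refine lt_of_le_of_ne hxm fun he => ?_
    have h1 := hvH xm he.symm.le
    have h2 := hw0 xm
    simp only [hD, zero_add, ← he, hk] at hDm
    rw [mul_assoc, ← Real.rpow_add (by positivity)] at hDm
    simp at hDm
    linarith
  have hpos : 0 < ‖xm - x1‖ ^ 2 := by have := hρ.trans hlt; positivity
  have hloc : IsLocalMax D xm := by
    refine hmax.isLocalMax ?_
    have : IsOpen {y : EuclideanSpace ℝ (Fin n) | ρ < ‖y - x1‖} :=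
      isOpen_lt continuous_const (by fun_prop)
    exact mem_of_superset (this.mem_nhds hlt) fun y (hy : ρ < ‖y - x1‖) => hy.le
  have hHD := ((hasH_pow (K := 0) (q := -q) (x := xm) (x0 := x1)
    (by simpa using hpos)).const_mul k).sub ((hasH_hess h.hv xm).add (hwH xm))
  have := hHD.tr2_nonpos hloc (h.symm xm) (h.pos xm)
  rw [tr2_sub, tr2_add, tr2_smul, tr2_pow, h.heq] at this
  simp only [zero_add] at this
  set S := ‖xm - x1‖ ^ 2 with hS
  have e1 : S ^ (-q - 1) = S ^ (-q - 2) * S := by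
    rw [← Real.rpow_add_one hpos.ne']; congr 1; ring
  have hp : 0 < S ^ (-q - 2) := Real.rpow_pos_of_pos hpos _
  have ht := trace_le (h.hi xm)
  have hl := h.lo xm (xm - x1)
  rw [← hS] at hl
  have h1 : 0 ≤ 2 * (q + 1) * QF (a xm) (xm - x1) - S * (a xm).trace := by
    have h2 := mul_le_mul_of_nonneg_left ht hpos.le
    have h3 := mul_le_mul_of_nonneg_left hl (show 0 ≤ 2 * (q + 1) by linarith)
    have h4 := mul_le_mul_of_nonneg_left hq2 hpos.le
    linarith
  have h5 : 0 ≤ k * (2 * (-q * S ^ (-q - 1)) * (a xm).trace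
      + 4 * (-q * (-q - 1) * S ^ (-q - 2)) * QF (a xm) (xm - x1)) := by
    have : k * (2 * (-q * S ^ (-q - 1)) * (a xm).trace
      + 4 * (-q * (-q - 1) * S ^ (-q - 2)) * QF (a xm) (xm - x1)) =
      k * (2 * q * S ^ (-q - 2) * (2 * (q + 1) * QF (a xm) (xm - x1) - S * (a xm).trace)) := by
      rw [e1]; ring
    rw [this]; positivity
  have := hwL xm
  have := le_abs_self (f xm)
  linarith

set_option maxHeartbeats 800000 in
lemma CoreHyp.holder (h : CoreHyp n ζ ε C lam Lam Cf Rf a f v) {η : ℝ} (hη0 : 0 ≤ η)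
    (hη : 8 * n * η ≤ 1) {x1 : EuclideanSpace ℝ (Fin n)} {r M : ℝ} (hr : 0 < r) (hM : 0 < M)
    (hnear : ∀ x, ‖x - x1‖ ≤ r →
      (∀ p, (1 - η) * ‖p‖ ^ 2 ≤ QF (a x) p) ∧ ∀ p, QF (a x) p ≤ (1 + η) * ‖p‖ ^ 2)
    (hv0 : ∀ x, ‖x - x1‖ ≤ r → 0 ≤ v x) (hvM : ∀ x, ‖x - x1‖ ≤ r → v x ≤ M)
    (hf : ∀ x, ‖x - x1‖ ≤ r → |f x| * r ^ 2 ≤ M) (y : EuclideanSpace ℝ (Fin n))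
    (hy : ‖y - x1‖ ≤ r) :
    v x1 - v y ≤ 4 * n * M / (r ^ 2) ^ (1 / 4 : ℝ) * (‖x1 - y‖ ^ 2) ^ (1 / 4 : ℝ) := by
  have hn : (3:ℝ) ≤ n := by exact_mod_cast h.hn
  set τ := (r ^ 2) ^ (1 / 4 : ℝ) with hτ
  have hτ0 : 0 < τ := by positivity
  have hτ4 : τ ^ 4 = r ^ 2 := rpow_14 (by positivity)
  set A := 4 * n * M / τ with hA
  have hA0 : 0 < A := by positivity
  set B := 4 * M / r ^ 2 with hB
  have hB0 : 0 < B := by positivity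
  by_contra hcon
  push Not at hcon
  have hvc : Continuous v := h.hv.continuous
  set T := (Metric.closedBall x1 r) ×ˢ (Metric.closedBall x1 r) with hT
  set G : EuclideanSpace ℝ (Fin n) × EuclideanSpace ℝ (Fin n) → ℝ := fun P =>
    v P.1 - v P.2 - A * (‖P.1 - P.2‖ ^ 2) ^ (1 / 4 : ℝ) - B * (‖P.1 - x1‖ ^ 2) - 0 * v P.2 with hG
  have hGc : Continuous G := by
    have : Continuous fun P : EuclideanSpace ℝ (Fin n) × EuclideanSpace ℝ (Fin n) =>
      (‖P.1 - P.2‖ ^ 2) ^ (1 / 4 : ℝ) :=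
      Continuous.rpow_const (by fun_prop) fun x => Or.inr (by norm_num)
    fun_prop
  have hTk : IsCompact T := (isCompact_closedBall _ _).prod (isCompact_closedBall _ _)
  have h1T : (x1, y) ∈ T := by
    simp [hT, hr.le, dist_eq_norm, hy]
  obtain ⟨⟨x', y'⟩, hmem, hmax⟩ := hTk.exists_isMaxOn ⟨_, h1T⟩ hGc.continuousOn
  have hpos : 0 < G (x', y') := by
    refine lt_of_lt_of_le ?_ (hmax h1T)
    simp only [hG, sub_self, norm_zero]
    norm_num
    norm_num at hcon
    linarith
  simp only [hT, Set.mem_prod, Metric.mem_closedBall, dist_eq_norm] at hmem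
  obtain ⟨hx', hy'⟩ := hmem
  have hGv : G (x', y') = v x' - v y' - A * (‖x' - y'‖ ^ 2) ^ (1 / 4 : ℝ) - B * (‖x' - x1‖ ^ 2) := by
    simp [hG]
  rw [hGv] at hpos
  have b1 := hvM x' hx'
  have b2 := hv0 y' hy'
  set σ := (‖x' - y'‖ ^ 2) ^ (1 / 4 : ℝ) with hσ
  have hσ0 : 0 ≤ σ := by positivity
  have hσ4 : σ ^ 4 = ‖x' - y'‖ ^ 2 := rpow_14 (by positivity)
  have hne : x' ≠ y' := by
    rintro rfl
    have : 0 ≤ A * σ := by positivity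
    have : 0 ≤ B * ‖x' - x1‖ ^ 2 := by positivity
    linarith
  have hσpos : 0 < σ := by
    have : 0 < ‖x' - y'‖ := norm_pos_iff.mpr (sub_ne_zero.mpr hne)
    positivity
  have c1 : ‖x' - x1‖ < r / 2 := by
    have h1 : B * ‖x' - x1‖ ^ 2 < M := by
      have : 0 ≤ A * σ := by positivity
      linarith
    rw [hB, div_mul_eq_mul_div, div_lt_iff₀ (by positivity)] at h1
    have : ‖x' - x1‖ ^ 2 < (r / 2) ^ 2 := by nlinarith
    exact lt_of_pow_lt_pow_left₀ 2 (by positivity) this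
  have c2 : 4 * n * σ < τ := by
    have h1 : A * σ < M := by
      have : 0 ≤ B * ‖x' - x1‖ ^ 2 := by positivity
      linarith
    rw [hA, div_mul_eq_mul_div, div_lt_iff₀ (by positivity)] at h1
    nlinarith
  have c3 : ‖x' - y'‖ < r / 2 := by
    have h1 : (2 * σ) ^ 4 < τ ^ 4 := by
      apply pow_lt_pow_left₀ _ (by positivity) (by norm_num)
      nlinarith
    rw [mul_pow, hσ4, hτ4] at h1
    have : ‖x' - y'‖ ^ 2 < (r / 2) ^ 2 := by nlinarith [sq_nonneg ‖x' - y'‖]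
    exact lt_of_pow_lt_pow_left₀ 2 (by positivity) this
  have c4 : ‖y' - x1‖ < r := by
    have : ‖y' - x1‖ ≤ ‖x' - y'‖ + ‖x' - x1‖ := by
      have := norm_sub_le (x' - x1) (x' - y')
      rw [show x' - x1 - (x' - y') = y' - x1 by abel] at this
      linarith
    linarith
  have hloc : IsLocalMax G (x', y') := by
    refine hmax.isLocalMax (prod_mem_nhds ?_ ?_)
    · exact mem_of_superset (Metric.isOpen_ball.mem_nhds (by
        rw [Metric.mem_ball, dist_eq_norm]; linarith)) (Metric.ball_subset_closedBall)
    · exact mem_of_superset (Metric.isOpen_ball.mem_nhds (by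
        rw [Metric.mem_ball, dist_eq_norm]; linarith)) (Metric.ball_subset_closedBall)
  obtain ⟨n1, n2⟩ := hnear x' hx'
  obtain ⟨m1, m2⟩ := hnear y' hy'
  have hquad : HasH (fun z : EuclideanSpace ℝ (Fin n) => B * ‖z - x1‖ ^ 2) x' _ :=
    (hasH_radial (F := fun s => s) (F1 := fun _ => 1) (F2 := 0) (x0 := x1) (x := x')
      (Eventually.of_forall fun s => hasDerivAt_id s) (hasDerivAt_const _ _)).const_mul B
  have key := doubling hη0 hη (by have := h.hn; omega) hA0.le (h.symm x') (h.symm y') n1 n2 m1 m2 hne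
    (hasH_hess h.hv x') (hasH_hess h.hv y') hquad ((hasH_hess h.hv y').const_mul 0) hloc
  rw [tr2_smul, tr2_smul, tr2_pow, h.heq, h.heq, rpow_m34 (by positivity), ← hσ] at key
  have ht : (a x').trace ≤ 2 * n := by
    have h1 := trace_le n2
    have e : (n:ℝ) * (1 + η) = n + n * η := by ring
    rw [e] at h1
    linarith
  have f1 := hf x' hx'
  have f2 := hf y' hy'
  have g1 := neg_abs_le (f x')
  have g2 := le_abs_self (f y')
  have hr2 : 0 < r ^ 2 := by positivity
  -- multiply by r ^ 2
  have hBr : B * r ^ 2 = 4 * M := by rw [hB]; field_simp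
  have k1 : - (2 * M + 16 * n * M) ≤ (f x' - f y' - B * (2 * 1 * (a x').trace)) * r ^ 2 := by
    have e : (f x' - f y' - B * (2 * 1 * (a x').trace)) * r ^ 2 =
      f x' * r ^ 2 - f y' * r ^ 2 - (B * r ^ 2) * (2 * (a x').trace) := by ring
    rw [e, hBr]
    have q1 := mul_le_mul_of_nonneg_right g1 hr2.le
    have q2 := mul_le_mul_of_nonneg_right g2 hr2.le
    have q3 := mul_le_mul_of_nonneg_left ht hM.le
    linarith
  have k2 : 64 * n * M ≤ A / 4 * (σ ^ 3)⁻¹ * r ^ 2 := by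
    have e : A / 4 * (σ ^ 3)⁻¹ * r ^ 2 = n * M * (τ / σ) ^ 3 := by
      rw [hA, ← hτ4]; field_simp
    rw [e]
    have : (4:ℝ) ≤ τ / σ := by
      rw [le_div_iff₀ hσpos]; nlinarith
    have : (4:ℝ) ^ 3 ≤ (τ / σ) ^ 3 := by gcongr
    have hnM : 0 < n * M := by positivity
    nlinarith
  have k3 := mul_le_mul_of_nonneg_right key hr2.le
  have : 0 < (n:ℝ) * M := by positivity
  have : 3 * M ≤ n * M := mul_le_mul_of_nonneg_right hn hM.le
  linarith

end bounded

section bounded2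
variable {n : ℕ} {ζ ε C lam Lam Cf Rf : ℝ}
  {a : EuclideanSpace ℝ (Fin n) → Matrix (Fin n) (Fin n) ℝ}
  {f v : EuclideanSpace ℝ (Fin n) → ℝ}

lemma bd_aux {n P H τ : ℝ} (hn : 0 < n) (hP : 0 < P) (hτ : 0 < τ) :
    4 * n * (P * H) / τ * (1 / (8 * n * P) * τ) = H / 2 := by
  field_simp
  ring

set_option maxHeartbeats 1600000 in
lemma CoreHyp.bounded (h : CoreHyp n ζ ε C lam Lam Cf Rf a f v) (hv0 : ∀ x, 0 ≤ v x) :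
    ∃ M : ℝ, ∀ x, v x ≤ M := by
  have hn : (3:ℝ) ≤ n := by exact_mod_cast h.hn
  have hlam := h.hlam
  have hLam := h.hLam
  have hvc : Continuous v := h.hv.continuous
  obtain ⟨w, W, B, hwc, hwH, hw0, hwB, hwL⟩ := h.barrier
  obtain ⟨R0, hR0, hnear⟩ := h.eta (η := 1 / (8 * n)) (by positivity)
  obtain ⟨F, hF⟩ := h.fbound (K := 0) (s := 1) le_rfl zero_le_one (by have := h.hζ; linarith)
  simp only [zero_add, Real.rpow_one] at hF
  obtain ⟨M0, hM0⟩ := (isCompact_closedBall (0 : EuclideanSpace ℝ (Fin n))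
    (2 * R0)).exists_bound_of_continuousOn hvc.continuousOn
  set q : ℝ := n * Lam / (2 * lam) with hq
  have hq0 : 0 < q := by positivity
  have hq2 : n * Lam ≤ 2 * (q + 1) * lam := by
    have : 2 * (q + 1) * lam = n * Lam + 2 * lam := by rw [hq]; field_simp
    linarith
  -- the constants
  set m : ℝ := 2 * q with hm
  have hm0 : 0 < m := by positivity
  set P : ℝ := 2 ^ m with hP
  have hP1 : 1 ≤ P := Real.one_le_rpow (by norm_num) hm0.le
  set κ : ℝ := (1 / (8 * n * P)) ^ 2 with hκ
  have hκ0 : 0 < κ := by positivity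
  have hκ1 : κ ≤ 1 := by
    rw [hκ]
    apply pow_le_one₀ (by positivity)
    rw [div_le_one (by positivity)]
    nlinarith
  set V : ℝ := v 0 + B with hV
  have hV0 : 0 ≤ V := by have := hv0 0; have := hw0 0; have := hwB 0; linarith
  set D : ℝ := max (max F M0) (2 * V * (κ / 2) ^ (-m)) with hD
  have hM00 : 0 ≤ M0 := (norm_nonneg _).trans (hM0 0 (by simp; linarith))
  have hD0 : 0 ≤ D := hM00.trans ((le_max_right _ _).trans (le_max_left _ _))
  refine ⟨D * P, fun x => ?_⟩
  set R : ℝ := 2 * ‖x‖ + 1 with hR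
  have hRpos : 0 < R := by positivity
  set g : EuclideanSpace ℝ (Fin n) → ℝ := fun y => v y * (R - ‖y‖) ^ m with hg
  have hgc : Continuous g :=
    hvc.mul (Continuous.rpow_const (by fun_prop) fun _ => Or.inr hm0.le)
  obtain ⟨x1, hx1, hmax⟩ := (isCompact_closedBall (0 : EuclideanSpace ℝ (Fin n)) R).exists_isMaxOn
    ⟨0, by simp [hRpos.le]⟩ hgc.continuousOn
  have hx1R : ‖x1‖ ≤ R := by simpa using hx1
  set d : ℝ := R - ‖x1‖ with hd
  have hd0 : 0 ≤ d := by linarith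
  have hdR : d ≤ R := by have := norm_nonneg x1; linarith
  set H : ℝ := v x1 with hH
  -- main claim
  have claim : H * d ^ m ≤ D * R ^ m := by
    by_cases hHD : H ≤ max F M0
    · exact mul_le_mul (hHD.trans (le_max_left _ _)) (Real.rpow_le_rpow hd0 hdR hm0.le)
        (by positivity) hD0
    push Not at hHD
    have hHF : F < H := lt_of_le_of_lt (le_max_left _ _) hHD
    have hHM : M0 < H := lt_of_le_of_lt (le_max_right _ _) hHD
    have hH0 : 0 < H := by linarith
    rcases hd0.eq_or_lt with hd00 | hd00
    · rw [← hd00, Real.zero_rpow hm0.ne', mul_zero]; positivity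
    have hx1R0 : 2 * R0 < ‖x1‖ := by
      by_contra hc
      push Not at hc
      have := hM0 x1 (by simpa using hc)
      have := le_abs_self (v x1)
      rw [Real.norm_eq_abs] at *
      linarith
    have hx1p : 0 < ‖x1‖ := by linarith
    set μ : ℝ := min d ‖x1‖ with hμ
    have hμ0 : 0 < μ := lt_min hd00 hx1p
    have hμd : μ ≤ d := min_le_left _ _
    have hμx : μ ≤ ‖x1‖ := min_le_right _ _
    set r : ℝ := μ / 2 with hr
    have hr0 : 0 < r := by positivity
    have hball : ∀ y, ‖y - x1‖ ≤ r → ‖x1‖ - r ≤ ‖y‖ ∧ ‖y‖ ≤ ‖x1‖ + r := fun y hy => by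
      have h1 := norm_sub_norm_le x1 y
      have h2 := norm_sub_norm_le y x1
      rw [norm_sub_rev] at h1
      constructor <;> linarith
    have hhold := fun y hy => h.holder (η := 1 / (8 * n)) (x1 := x1) (r := r) (M := P * H) (by positivity)
      (le_of_eq (by field_simp)) hr0 (by positivity)
      (fun y hy => hnear y (by linarith [(hball y hy).1])) (fun y _ => hv0 y)
      (fun y hy => by
        have hb := (hball y hy).2
        have h1 : d / 2 ≤ R - ‖y‖ := by linarith
        have h2 : g y ≤ g x1 := hmax (by simp; linarith)
        have h3 : v y * (d / 2) ^ m ≤ H * d ^ m :=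
          (mul_le_mul_of_nonneg_left (Real.rpow_le_rpow (by positivity) h1 hm0.le) (hv0 y)).trans h2
        rw [Real.div_rpow hd0 (by norm_num), ← hP, ← mul_div_assoc, div_le_iff₀ (by positivity)] at h3
        have hdm : 0 < d ^ m := Real.rpow_pos_of_pos hd00 _
        nlinarith)
      (fun y hy => by
        have hb := (hball y hy).1
        have h1 : r ≤ ‖y‖ := by linarith
        have h2 : |f y| * r ^ 2 ≤ |f y| * ‖y‖ ^ 2 := by gcongr
        have h3 := hF y
        nlinarith) y hy
    set ρ : ℝ := κ * r with hρ
    have hρ0 : 0 < ρ := by positivity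
    have hρr : ρ ≤ r := by rw [hρ]; nlinarith
    have hlow : ∀ y, ‖y - x1‖ ≤ ρ → H / 2 ≤ v y := fun y hy => by
      have h1 := hhold y (hy.trans hρr)
      have h2 : (‖x1 - y‖ ^ 2) ^ (1 / 4 : ℝ) ≤ 1 / (8 * n * P) * (r ^ 2) ^ (1 / 4 : ℝ) := by
        calc (‖x1 - y‖ ^ 2) ^ (1 / 4 : ℝ) ≤ (ρ ^ 2) ^ (1 / 4 : ℝ) := by
              rw [norm_sub_rev]; gcongr
          _ = _ := by
              rw [hρ, mul_pow, Real.mul_rpow (by positivity) (by positivity), hκ]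
              congr 1
              rw [← pow_mul, ← Real.rpow_natCast, ← Real.rpow_mul (by positivity)]
              norm_num
      have h3 := mul_le_mul_of_nonneg_left h2
        (show 0 ≤ 4 * n * (P * H) / (r ^ 2) ^ (1 / 4 : ℝ) by positivity)
      have h4 : 4 * n * (P * H) / (r ^ 2) ^ (1 / 4 : ℝ) * (1 / (8 * n * P) * (r ^ 2) ^ (1 / 4 : ℝ))
          = H / 2 := by
        exact bd_aux (by linarith) (by linarith) (by positivity)
      linarith
    have hfin := h.lower hwc hwH hw0 hwL hv0 hq0 hq2 hρ0 (by positivity) hlow 0 (by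
      rw [zero_sub, norm_neg]; linarith)
    rw [zero_sub, norm_neg] at hfin
    have hfin2 : H / 2 * ρ ^ m * ‖x1‖ ^ (-m) ≤ V := by
      have e1 : (ρ ^ 2) ^ q = ρ ^ m := by
        rw [← Real.rpow_natCast, ← Real.rpow_mul hρ0.le, hm]; norm_num
      have e2 : (‖x1‖ ^ 2) ^ (-q) = ‖x1‖ ^ (-m) := by
        rw [← Real.rpow_natCast, ← Real.rpow_mul hx1p.le, hm]; norm_num
      rw [e1, e2] at hfin
      exact hfin.trans (by have := hwB 0; linarith)
    have e3 : ρ ^ m = (κ / 2) ^ m * μ ^ m := by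
      rw [← Real.mul_rpow (by positivity) hμ0.le]; congr 1; rw [hρ, hr]; ring
    have hxm : 0 < ‖x1‖ ^ m := Real.rpow_pos_of_pos hx1p _
    have hkm : 0 < (κ / 2) ^ m := by positivity
    have hfin3 : H * μ ^ m ≤ 2 * V * (κ / 2) ^ (-m) * ‖x1‖ ^ m := by
      rw [Real.rpow_neg hx1p.le, e3, ← div_eq_mul_inv, div_le_iff₀ hxm] at hfin2
      rw [Real.rpow_neg (by positivity), ← div_eq_mul_inv, div_mul_eq_mul_div, le_div_iff₀ hkm]
      nlinarith
    have hDV : 2 * V * (κ / 2) ^ (-m) ≤ D := le_max_right _ _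
    have hfin4 : H * μ ^ m ≤ D * ‖x1‖ ^ m := hfin3.trans (by gcongr)
    rcases le_total d ‖x1‖ with hc | hc
    · rw [show μ = d from min_eq_left hc] at hfin4
      refine hfin4.trans (by gcongr)
    · rw [show μ = ‖x1‖ from min_eq_right hc] at hfin4
      have : H ≤ D := le_of_mul_le_mul_right hfin4 hxm
      exact mul_le_mul this (Real.rpow_le_rpow hd0 hdR hm0.le) (by positivity) hD0
  have h1 : g x ≤ g x1 := hmax (by simp; linarith [norm_nonneg x])
  have h2 : v x * (R / 2) ^ m ≤ D * R ^ m := by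
    refine le_trans ?_ (h1.trans claim)
    refine mul_le_mul_of_nonneg_left (Real.rpow_le_rpow (by positivity) ?_ hm0.le) (hv0 x)
    linarith
  rw [Real.div_rpow hRpos.le (by norm_num), ← hP, ← mul_div_assoc, div_le_iff₀ (by positivity)] at h2
  have hRm : 0 < R ^ m := Real.rpow_pos_of_pos hRpos _
  have : v x * R ^ m ≤ D * P * R ^ m := by linarith
  exact le_of_mul_le_mul_right this hRm

end bounded2

section exterior
variable {n : ℕ} {ζ ε C lam Lam Cf Rf : ℝ}
  {a : EuclideanSpace ℝ (Fin n) → Matrix (Fin n) (Fin n) ℝ}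
  {f v : EuclideanSpace ℝ (Fin n) → ℝ}

lemma CoreHyp.psi (h : CoreHyp n ζ ε C lam Lam Cf Rf a f v) (x : EuclideanSpace ℝ (Fin n)) :
    ∃ P : Matrix (Fin n) (Fin n) ℝ,
      HasH (fun y : EuclideanSpace ℝ (Fin n) => (1 + ‖y - 0‖ ^ 2) ^ (1 / 2 : ℝ)) x P ∧
      tr2 (a x) P ≤ n * Lam := by
  refine ⟨_, hasH_pow (by positivity), ?_⟩
  rw [tr2_pow]
  have h1 := h.pos x (x - 0)
  have h2 := trace_le (h.hi x)
  have h3 : (1 + ‖x - 0‖ ^ 2) ^ (1 / 2 - 1 : ℝ) ≤ 1 :=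
    Real.rpow_le_one_of_one_le_of_nonpos (by nlinarith [norm_nonneg (x - 0)]) (by norm_num)
  have h4 : 0 ≤ (1 + ‖x - 0‖ ^ 2) ^ (1 / 2 - 1 : ℝ) := by positivity
  have h5 : 0 ≤ (1 + ‖x - 0‖ ^ 2) ^ (1 / 2 - 2 : ℝ) := by positivity
  have h6 := mul_nonneg h5 h1
  have h7 : 0 ≤ (a x).trace := by
    have := le_trace (h.lo x)
    have := h.hlam
    have : 0 ≤ n * lam := by positivity
    linarith
  have h8 := mul_le_mul_of_nonneg_right h3 h7
  nlinarith

lemma CoreHyp.ext_aux (h : CoreHyp n ζ ε C lam Lam Cf Rf a f v) {M R1 : ℝ}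
    (hM0 : 0 < M) (hM : ∀ x, |v x| ≤ M)
    (hnear : ∀ x : EuclideanSpace ℝ (Fin n), R1 ≤ ‖x‖ →
      (∀ p, (1 - 1 / (8 * n)) * ‖p‖ ^ 2 ≤ QF (a x) p) ∧
        ∀ p, QF (a x) p ≤ (1 + 1 / (8 * n)) * ‖p‖ ^ 2)
    {b : EuclideanSpace ℝ (Fin n) → ℝ} {Hb : EuclideanSpace ℝ (Fin n) → Matrix (Fin n) (Fin n) ℝ}
    (hbc : ContinuousOn b {x | R1 ≤ ‖x‖})
    (hb0 : ∀ x, R1 ≤ ‖x‖ → 0 ≤ b x)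
    (hbH : ∀ x, R1 < ‖x‖ → HasH b x (Hb x))
    (hbL : ∀ x, R1 < ‖x‖ → tr2 (a x) (Hb x) ≤ -|f x|)
    (hb1 : ∀ x, ‖x‖ = R1 → 2 * M ≤ b x)
    {e e' : ℝ} (he : 0 < e) (he' : 0 < e')
    (hee : e' * (n * Lam) < e / 4 * ((2 * M / e) ^ 3)⁻¹)
    {x y : EuclideanSpace ℝ (Fin n)} (hx : R1 ≤ ‖x‖) (hy : R1 ≤ ‖y‖) :
    v x - v y - e * (‖x - y‖ ^ 2) ^ (1 / 4 : ℝ)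
      - (b x + e' * (1 + ‖x - 0‖ ^ 2) ^ (1 / 2 : ℝ)) - b y ≤ 0 := by
  by_contra hcon
  push Not at hcon
  have hn : 3 ≤ n := h.hn
  have hvc : Continuous v := h.hv.continuous
  have hvd : ∀ x y, v x - v y ≤ 2 * M := fun x y => by
    have h1 := abs_le.mp (hM x); have h2 := abs_le.mp (hM y); linarith
  set G : EuclideanSpace ℝ (Fin n) × EuclideanSpace ℝ (Fin n) → ℝ := fun P =>
    v P.1 - v P.2 - e * (‖P.1 - P.2‖ ^ 2) ^ (1 / 4 : ℝ)
      - (b P.1 + e' * (1 + ‖P.1 - 0‖ ^ 2) ^ (1 / 2 : ℝ)) - b P.2 with hG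
  set T : Set (EuclideanSpace ℝ (Fin n) × EuclideanSpace ℝ (Fin n)) :=
    {P | R1 ≤ ‖P.1‖ ∧ R1 ≤ ‖P.2‖} with hT
  have hTc : IsClosed T :=
    (isClosed_le continuous_const continuous_fst.norm).inter (isClosed_le continuous_const continuous_snd.norm)
  have hGc : ContinuousOn G T := by
    have c1 : Continuous fun P : EuclideanSpace ℝ (Fin n) × EuclideanSpace ℝ (Fin n) =>
      (‖P.1 - P.2‖ ^ 2) ^ (1 / 4 : ℝ) :=
      Continuous.rpow_const (by fun_prop) fun x => Or.inr (by norm_num)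
    have c2 : Continuous fun P : EuclideanSpace ℝ (Fin n) × EuclideanSpace ℝ (Fin n) =>
      (1 + ‖P.1 - 0‖ ^ 2) ^ (1 / 2 : ℝ) :=
      Continuous.rpow_const (by fun_prop) fun x => Or.inr (by norm_num)
    have c3 : ContinuousOn (fun P : EuclideanSpace ℝ (Fin n) × EuclideanSpace ℝ (Fin n) => b P.1) T :=
      hbc.comp continuous_fst.continuousOn fun P hP => hP.1
    have c4 : ContinuousOn (fun P : EuclideanSpace ℝ (Fin n) × EuclideanSpace ℝ (Fin n) => b P.2) T :=
      hbc.comp continuous_snd.continuousOn fun P hP => hP.2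
    have c5 : Continuous fun P : EuclideanSpace ℝ (Fin n) × EuclideanSpace ℝ (Fin n) =>
      v P.1 - v P.2 - e * (‖P.1 - P.2‖ ^ 2) ^ (1 / 4 : ℝ) := by fun_prop
    exact (c5.continuousOn.sub (c3.add (c2.const_mul e').continuousOn)).sub c4
  have key : ∀ P ∈ T, 0 < G P → e * (‖P.1 - P.2‖ ^ 2) ^ (1 / 4 : ℝ) ≤ 2 * M ∧ e' * ‖P.1‖ ≤ 2 * M := by
    rintro ⟨p, q⟩ ⟨hp, hq⟩ hpos
    simp only [hG] at hpos hp hq ⊢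
    have h1 := hvd p q
    have h2 := hb0 p hp
    have h3 := hb0 q hq
    have h4 : ‖p‖ ≤ (1 + ‖p - 0‖ ^ 2) ^ (1 / 2 : ℝ) := by
      rw [← Real.sqrt_eq_rpow, sub_zero]
      exact Real.le_sqrt_of_sq_le (by linarith)
    have h5 : 0 ≤ e * (‖p - q‖ ^ 2) ^ (1 / 4 : ℝ) := by positivity
    have h6 := mul_le_mul_of_nonneg_left h4 he'.le
    have h7 : 0 ≤ e' * ‖p‖ := by positivity
    constructor <;> linarith
  have hxyT : (x, y) ∈ T := ⟨hx, hy⟩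
  have hGxy : 0 < G (x, y) := hcon
  set ρ : ℝ := 2 * M / e' + (2 * M / e) ^ 2 with hρ
  obtain ⟨⟨x', y'⟩, hmem, hmax⟩ := hGc.exists_isMaxOn' hTc (x₀ := (x, y)) hxyT (by
    have hK : IsCompact (Metric.closedBall (0 : EuclideanSpace ℝ (Fin n)) ρ ×ˢ
      Metric.closedBall (0 : EuclideanSpace ℝ (Fin n)) ρ) :=
        (isCompact_closedBall _ _).prod (isCompact_closedBall _ _)
    filter_upwards [mem_inf_of_left hK.compl_mem_cocompact, mem_inf_of_right (mem_principal_self T)]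
      with P hP hPT
    by_contra hc
    push Not at hc
    apply hP
    obtain ⟨k1, k2⟩ := key P hPT (hGxy.trans hc)
    obtain ⟨p, q⟩ := P
    simp only at k1 k2
    have k3 : ‖p‖ ≤ 2 * M / e' := by rw [le_div_iff₀ he']; linarith
    have k4 : (‖p - q‖ ^ 2) ^ (1 / 4 : ℝ) ≤ 2 * M / e := by rw [le_div_iff₀ he]; linarith
    have k5 : ‖p - q‖ ≤ (2 * M / e) ^ 2 := by
      have k6 := rpow_14 (S := ‖p - q‖ ^ 2) (by positivity)
      have k7 : ‖p - q‖ = ((‖p - q‖ ^ 2) ^ (1 / 4 : ℝ)) ^ 2 := by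
        rw [← sq_eq_sq₀ (by positivity) (by positivity)]
        rw [← pow_mul]
        exact k6.symm
      rw [k7]
      gcongr
    have k8 : ‖q‖ ≤ ‖p‖ + ‖p - q‖ := by
      have := norm_sub_norm_le q p
      rw [norm_sub_rev] at this; linarith
    simp only [Set.mem_prod, mem_closedBall_zero_iff]
    have : 0 ≤ (2 * M / e) ^ 2 := by positivity
    constructor <;> linarith)
  have hpos : 0 < G (x', y') := hGxy.trans_le (hmax hxyT)
  obtain ⟨k1, -⟩ := key _ hmem hpos
  obtain ⟨hx', hy'⟩ := hmem
  simp only at hx' hy' k1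
  have hpos' := hpos
  simp only [hG] at hpos'
  have p1 : 0 ≤ e * (‖x' - y'‖ ^ 2) ^ (1 / 4 : ℝ) := by positivity
  have p2 : 0 ≤ e' * (1 + ‖x' - 0‖ ^ 2) ^ (1 / 2 : ℝ) := by positivity
  have p3 := hvd x' y'
  have p4 := hb0 x' hx'
  have p5 := hb0 y' hy'
  have hx1 : R1 < ‖x'‖ := lt_of_le_of_ne hx' fun hc => by
    have := hb1 x' hc.symm; linarith
  have hy1 : R1 < ‖y'‖ := lt_of_le_of_ne hy' fun hc => by
    have := hb1 y' hc.symm; linarith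
  have hne : x' ≠ y' := by
    rintro rfl
    linarith
  have hloc : IsLocalMax G (x', y') := by
    refine hmax.isLocalMax ?_
    have o1 : IsOpen {P : EuclideanSpace ℝ (Fin n) × EuclideanSpace ℝ (Fin n) |
        R1 < ‖P.1‖ ∧ R1 < ‖P.2‖} :=
      (isOpen_lt continuous_const continuous_fst.norm).inter (isOpen_lt continuous_const continuous_snd.norm)
    exact mem_of_superset (o1.mem_nhds ⟨hx1, hy1⟩) fun P hP => ⟨hP.1.le, hP.2.le⟩
  obtain ⟨Q, hQ, hQL⟩ := h.psi x'
  have hD := doubling (η := 1 / (8 * n)) (A := e) (by positivity)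
    (le_of_eq (by have : (0:ℝ) < n := by exact_mod_cast (by omega : 0 < n)
                  field_simp)) (by omega) he.le
    (h.symm x') (h.symm y') (hnear x' hx').1 (hnear x' hx').2 (hnear y' hy').1 (hnear y' hy').2
    hne (hasH_hess h.hv x') (hasH_hess h.hv y') ((hbH x' hx1).add (hQ.const_mul e')) (hbH y' hy1) hloc
  rw [h.heq, h.heq, tr2_add, tr2_smul, rpow_m34 (by
    have : 0 < ‖x' - y'‖ := norm_pos_iff.mpr (sub_ne_zero.mpr hne)
    positivity)] at hD
  have q1 := hbL x' hx1
  have q2 := hbL y' hy1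
  have q3 := neg_abs_le (f x')
  have q4 := le_abs_self (f y')
  have q5 := mul_le_mul_of_nonneg_left hQL he'.le
  set σ := (‖x' - y'‖ ^ 2) ^ (1 / 4 : ℝ) with hσ
  have hσ0 : 0 < σ := by
    have : 0 < ‖x' - y'‖ := norm_pos_iff.mpr (sub_ne_zero.mpr hne)
    positivity
  have k4 : σ ≤ 2 * M / e := by rw [le_div_iff₀ he]; linarith
  have k5 : ((2 * M / e) ^ 3)⁻¹ ≤ (σ ^ 3)⁻¹ := by gcongr
  have k6 := mul_le_mul_of_nonneg_left k5 (show 0 ≤ e / 4 by positivity)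
  linarith

lemma CoreHyp.exterior (h : CoreHyp n ζ ε C lam Lam Cf Rf a f v) {M R1 : ℝ}
    (hM0 : 0 < M) (hM : ∀ x, |v x| ≤ M)
    (hnear : ∀ x : EuclideanSpace ℝ (Fin n), R1 ≤ ‖x‖ →
      (∀ p, (1 - 1 / (8 * n)) * ‖p‖ ^ 2 ≤ QF (a x) p) ∧
        ∀ p, QF (a x) p ≤ (1 + 1 / (8 * n)) * ‖p‖ ^ 2)
    {b : EuclideanSpace ℝ (Fin n) → ℝ} {Hb : EuclideanSpace ℝ (Fin n) → Matrix (Fin n) (Fin n) ℝ}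
    (hbc : ContinuousOn b {x | R1 ≤ ‖x‖})
    (hb0 : ∀ x, R1 ≤ ‖x‖ → 0 ≤ b x)
    (hbH : ∀ x, R1 < ‖x‖ → HasH b x (Hb x))
    (hbL : ∀ x, R1 < ‖x‖ → tr2 (a x) (Hb x) ≤ -|f x|)
    (hb1 : ∀ x, ‖x‖ = R1 → 2 * M ≤ b x)
    {x y : EuclideanSpace ℝ (Fin n)} (hx : R1 ≤ ‖x‖) (hy : R1 ≤ ‖y‖) :
    v x - v y ≤ b x + b y := by
  have s1 : ∀ e : ℝ, 0 < e → v x - v y - e * (‖x - y‖ ^ 2) ^ (1 / 4 : ℝ) - b x - b y ≤ 0 := by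
    intro e he
    have hc : 0 < e / 4 * ((2 * M / e) ^ 3)⁻¹ := by positivity
    have t1 : Tendsto (fun e' : ℝ => e' * (n * Lam)) (𝓝[>] 0) (𝓝 (0 * (n * Lam))) :=
      tendsto_nhdsWithin_of_tendsto_nhds (tendsto_id.mul_const _)
    rw [zero_mul] at t1
    have t2 : Tendsto (fun e' : ℝ => v x - v y - e * (‖x - y‖ ^ 2) ^ (1 / 4 : ℝ)
      - (b x + e' * (1 + ‖x - 0‖ ^ 2) ^ (1 / 2 : ℝ)) - b y) (𝓝[>] 0)
      (𝓝 (v x - v y - e * (‖x - y‖ ^ 2) ^ (1 / 4 : ℝ)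
      - (b x + 0 * (1 + ‖x - 0‖ ^ 2) ^ (1 / 2 : ℝ)) - b y)) :=
      tendsto_nhdsWithin_of_tendsto_nhds (Continuous.tendsto (by fun_prop) 0)
    rw [zero_mul, add_zero] at t2
    refine le_of_tendsto t2 ?_
    filter_upwards [(tendsto_order.mp t1).2 _ hc, self_mem_nhdsWithin] with e' h1 h2
    exact h.ext_aux hM0 hM hnear hbc hb0 hbH hbL hb1 he h2 h1 hx hy
  have t2 : Tendsto (fun e : ℝ => v x - v y - e * (‖x - y‖ ^ 2) ^ (1 / 4 : ℝ) - b x - b y) (𝓝[>] 0)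
      (𝓝 (v x - v y - 0 * (‖x - y‖ ^ 2) ^ (1 / 4 : ℝ) - b x - b y)) :=
      tendsto_nhdsWithin_of_tendsto_nhds (Continuous.tendsto (by fun_prop) 0)
  have := le_of_tendsto t2 (by filter_upwards [self_mem_nhdsWithin] with e he using s1 e he)
  linarith

lemma CoreHyp.limit (h : CoreHyp n ζ ε C lam Lam Cf Rf a f v) {R1 : ℝ}
    {b : EuclideanSpace ℝ (Fin n) → ℝ}
    (hb : Tendsto b (cocompact _) (𝓝 0))
    (hvb : ∀ x y, R1 ≤ ‖x‖ → R1 ≤ ‖y‖ → v x - v y ≤ b x + b y) :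
    ∃ vinf : ℝ, ∀ x, R1 ≤ ‖x‖ → |v x - vinf| ≤ b x := by
  have : Nonempty (Fin n) := ⟨⟨0, by have := h.hn; omega⟩⟩
  have : Nontrivial (EuclideanSpace ℝ (Fin n)) := inferInstance
  have : NeBot (cocompact (EuclideanSpace ℝ (Fin n))) := inferInstance
  have hev : ∀ᶠ y in cocompact (EuclideanSpace ℝ (Fin n)), R1 ≤ ‖y‖ :=
    (tendsto_norm_cocompact_atTop (E := EuclideanSpace ℝ (Fin n))).eventually_ge_atTop R1
  have hcau : Cauchy (map v (cocompact (EuclideanSpace ℝ (Fin n)))) := by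
    rw [Metric.cauchy_iff]
    refine ⟨inferInstance, fun δ hδ => ?_⟩
    refine ⟨_, image_mem_map (inter_mem hev ((tendsto_order.mp hb).2 (δ / 2) (by linarith))), ?_⟩
    rintro _ ⟨x, ⟨hx, hbx⟩, rfl⟩ _ ⟨y, ⟨hy, hby⟩, rfl⟩
    have h1 := hvb x y hx hy
    have h2 := hvb y x hy hx
    simp only [Set.mem_ofPred_eq] at hbx hby
    rw [Real.dist_eq, abs_lt]
    constructor <;> linarith
  obtain ⟨vinf, hlim⟩ := CompleteSpace.complete hcau
  have hlim' : Tendsto v (cocompact _) (𝓝 vinf) := hlim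
  refine ⟨vinf, fun x hx => ?_⟩
  have h1 : v x - vinf ≤ b x + 0 :=
    le_of_tendsto_of_tendsto (tendsto_const_nhds.sub hlim') (tendsto_const_nhds.add hb)
      (by filter_upwards [hev] with y hy using hvb x y hx hy)
  have h2 : vinf - v x ≤ 0 + b x :=
    le_of_tendsto_of_tendsto (hlim'.sub tendsto_const_nhds) (hb.add tendsto_const_nhds)
      (by filter_upwards [hev] with y hy using hvb y x hy hx)
  rw [abs_le]; constructor <;> linarith

end exterior

section rates
variable {n : ℕ} {ζ ε C lam Lam Cf Rf : ℝ}
  {a : EuclideanSpace ℝ (Fin n) → Matrix (Fin n) (Fin n) ℝ}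
  {f v : EuclideanSpace ℝ (Fin n) → ℝ}

def Barr (ζ : ℝ) (a : EuclideanSpace ℝ (Fin n) → Matrix (Fin n) (Fin n) ℝ) (F : ℝ → ℝ) : Prop :=
  ∃ (Hb : EuclideanSpace ℝ (Fin n) → Matrix (Fin n) (Fin n) ℝ) (c : ℝ), 0 < c ∧
    ∀ᶠ x in cocompact (EuclideanSpace ℝ (Fin n)),
      ContinuousAt (fun y : EuclideanSpace ℝ (Fin n) => F (‖y‖ ^ 2)) x ∧
      HasH (fun y : EuclideanSpace ℝ (Fin n) => F (‖y‖ ^ 2)) x (Hb x) ∧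
      0 < F (‖x‖ ^ 2) ∧ tr2 (a x) (Hb x) ≤ -c * ‖x‖ ^ (-ζ)

lemma ev_cocompact {p : EuclideanSpace ℝ (Fin n) → Prop}
    (h : ∀ᶠ x in cocompact (EuclideanSpace ℝ (Fin n)), p x) :
    ∃ R : ℝ, ∀ x, R ≤ ‖x‖ → p x := by
  rw [← Metric.cobounded_eq_cocompact, ← comap_norm_atTop, eventually_comap] at h
  obtain ⟨R, hR⟩ := eventually_atTop.mp h
  exact ⟨R, fun x hx => hR _ hx x rfl⟩

lemma tendsto_nsq : Tendsto (fun x : EuclideanSpace ℝ (Fin n) => ‖x‖ ^ 2)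
    (cocompact (EuclideanSpace ℝ (Fin n))) atTop := by
  simpa using tendsto_norm_sub_sq (0 : EuclideanSpace ℝ (Fin n))

lemma CoreHyp.finish (h : CoreHyp n ζ ε C lam Lam Cf Rf a f v) {M : ℝ}
    (hM0 : 0 < M) (hM : ∀ x, |v x| ≤ M) {F : ℝ → ℝ} (hF : Barr ζ a F)
    (hF0 : Tendsto F atTop (𝓝 0)) :
    ∃ vinf K R : ℝ, 0 < K ∧ 1 < R ∧ ∀ x, R ≤ ‖x‖ → |v x - vinf| ≤ K * F (‖x‖ ^ 2) := by
  obtain ⟨Hb, c, hc, hev⟩ := hF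
  obtain ⟨R2, hR2⟩ := ev_cocompact hev
  have hn : (3:ℝ) ≤ n := by exact_mod_cast h.hn
  obtain ⟨R0, hR0, hnear⟩ := h.eta (η := 1 / (8 * n)) (by positivity)
  set R := max (max R2 R0) (max Rf 2) with hR
  have r1 : R2 ≤ R := (le_max_left _ _).trans (le_max_left _ _)
  have r2 : R0 ≤ R := (le_max_right _ _).trans (le_max_left _ _)
  have r3 : Rf ≤ R := (le_max_left _ _).trans (le_max_right _ _)
  have r4 : 2 ≤ R := (le_max_right _ _).trans (le_max_right _ _)
  have hFR : 0 < F (R ^ 2) := by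
    have : ∃ x : EuclideanSpace ℝ (Fin n), ‖x‖ = R := by
      refine ⟨EuclideanSpace.single ⟨0, by have := h.hn; omega⟩ R, ?_⟩
      simp; linarith
    obtain ⟨x, hx⟩ := this
    rw [← hx]
    exact (hR2 x (by rw [hx]; exact r1)).2.2.1
  set K := max (Cf / c) (2 * M / F (R ^ 2)) with hK
  have hK0 : 0 < K := lt_max_of_lt_right (by positivity)
  have hb0 : Tendsto (fun x : EuclideanSpace ℝ (Fin n) => K * F (‖x‖ ^ 2))
      (cocompact (EuclideanSpace ℝ (Fin n))) (𝓝 0) := by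
    simpa using (hF0.comp tendsto_nsq).const_mul K
  obtain ⟨vinf, hv⟩ := h.limit (R1 := R) hb0 (fun x y hx hy =>
    h.exterior (b := fun x => K * F (‖x‖ ^ 2)) (Hb := fun x => K • Hb x) hM0 hM
      (fun x hx => hnear x (r2.trans hx))
      (fun x hx => ((hR2 x (r1.trans hx)).1.const_mul K).continuousWithinAt)
      (fun x hx => mul_nonneg hK0.le (hR2 x (r1.trans hx)).2.2.1.le)
      (fun x hx => (hR2 x (r1.trans hx.le)).2.1.const_mul K)
      (fun x hx => by
        have hx0 : 0 < ‖x‖ := by linarith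
        have h1 := (hR2 x (r1.trans hx.le)).2.2.2
        have h2 := h.fdecay x (r3.trans hx.le)
        rw [tr2_smul]
        have h3 := mul_le_mul_of_nonneg_left h1 hK0.le
        have hz : 0 < ‖x‖ ^ ζ := Real.rpow_pos_of_pos hx0 _
        rw [Real.rpow_neg hx0.le] at h3
        have h4 : |f x| ≤ Cf * (‖x‖ ^ ζ)⁻¹ := by
          rw [← div_eq_mul_inv, le_div_iff₀ hz]; linarith
        have h5 : Cf ≤ K * c := by
          have := le_max_left (Cf / c) (2 * M / F (R ^ 2))
          rw [div_le_iff₀ hc] at this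
          exact this
        have h6 := mul_le_mul_of_nonneg_right h5 (inv_pos.mpr hz).le
        linarith)
      (fun x hx => by
        simp only [hx]
        have := le_max_right (Cf / c) (2 * M / F (R ^ 2))
        rw [div_le_iff₀ hFR] at this
        exact this) hx hy)
  exact ⟨vinf, K, R, hK0, by linarith, hv⟩

lemma CoreHyp.trQF (h : CoreHyp n ζ ε C lam Lam Cf Rf a f v) {x : EuclideanSpace ℝ (Fin n)}
    (hx : 0 < ‖x‖ ^ 2) : ∃ A t : ℝ, QF (a x) x = A * ‖x‖ ^ 2 ∧ (a x).trace = t ∧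
      1 - C * (‖x‖ ^ 2) ^ (-(ε / 2)) ≤ A ∧ A ≤ 1 + C * (‖x‖ ^ 2) ^ (-(ε / 2)) ∧
      n * (1 - C * (‖x‖ ^ 2) ^ (-(ε / 2))) ≤ t ∧ t ≤ n * (1 + C * (‖x‖ ^ 2) ^ (-(ε / 2))) := by
  have hx0 : x ≠ 0 := by rintro rfl; simp at hx
  have e : (‖x‖ ^ 2) ^ (-(ε / 2)) = ‖x‖ ^ (-ε) := by
    rw [← Real.rpow_natCast, ← Real.rpow_mul (norm_nonneg _)]; congr 1; push_cast; ring
  rw [e]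
  have hne := h.near x hx0
  have hb : ∀ p, (1 - C * ‖x‖ ^ (-ε)) * ‖p‖ ^ 2 ≤ QF (a x) p := fun p => by
    have := (abs_le.mp (hne p)).1; linarith
  have hb' : ∀ p, QF (a x) p ≤ (1 + C * ‖x‖ ^ (-ε)) * ‖p‖ ^ 2 := fun p => by
    have := (abs_le.mp (hne p)).2; linarith
  refine ⟨QF (a x) x / ‖x‖ ^ 2, _, by field_simp, rfl, ?_, ?_, le_trace hb, trace_le hb'⟩
  · rw [le_div_iff₀ hx]; exact hb x
  · rw [div_le_iff₀ hx]; exact hb' x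

lemma CoreHyp.tr2_radial (h : CoreHyp n ζ ε C lam Lam Cf Rf a f v) {p : ℝ}
    {x : EuclideanSpace ℝ (Fin n)} (hx : 0 < ‖x‖ ^ 2) :
    ∃ H : Matrix (Fin n) (Fin n) ℝ,
      HasH (fun y : EuclideanSpace ℝ (Fin n) => (‖y‖ ^ 2) ^ (-p)) x H ∧
      tr2 (a x) H = (‖x‖ ^ 2) ^ (-p - 1) * (2 * p) *
        (2 * (p + 1) * (QF (a x) x / ‖x‖ ^ 2) - (a x).trace) := by
  have := hasH_pow (K := 0) (q := -p) (x := x) (x0 := 0) (by simpa using hx)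
  simp only [zero_add, sub_zero] at this
  refine ⟨_, this, ?_⟩
  rw [tr2_pow]
  have e1 : (‖x‖ ^ 2) ^ (-p - 1) = (‖x‖ ^ 2) ^ (-p - 2) * ‖x‖ ^ 2 := by
    rw [← Real.rpow_add_one hx.ne']; congr 1; ring
  rw [e1]
  generalize (‖x‖ ^ 2) ^ (-p - 2) = U
  generalize ‖x‖ ^ 2 = S at hx
  field_simp
  ring

lemma sq_rpow_neg {r z : ℝ} (hr : 0 ≤ r) : (r ^ 2) ^ (-(z / 2)) = r ^ (-z) := by
  rw [← Real.rpow_natCast, ← Real.rpow_mul hr]; congr 1; push_cast; ring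

lemma cont_pow {p : ℝ} {x : EuclideanSpace ℝ (Fin n)} (hx : 0 < ‖x‖ ^ 2) :
    ContinuousAt (fun y : EuclideanSpace ℝ (Fin n) => (‖y‖ ^ 2) ^ p) x :=
  ContinuousAt.rpow_const (by fun_prop) (Or.inl hx.ne')

lemma tendsto_omega {e : ℝ} (he : 0 < e) (k : ℝ) :
    Tendsto (fun s : ℝ => k * s ^ (-e)) atTop (𝓝 0) := by
  simpa using (tendsto_rpow_neg_atTop he).const_mul k

lemma CoreHyp.barr_lt (h : CoreHyp n ζ ε C lam Lam Cf Rf a f v) (hζn : ζ < n) :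
    Barr ζ a (fun s => s ^ (-((ζ - 2) / 2))) := by
  have hζ := h.hζ
  have hn : (3:ℝ) ≤ n := by exact_mod_cast h.hn
  set p := (ζ - 2) / 2 with hp
  have hp0 : 0 < p := by rw [hp]; linarith
  have hex : ∀ x : EuclideanSpace ℝ (Fin n), ∃ H : Matrix (Fin n) (Fin n) ℝ, 0 < ‖x‖ ^ 2 →
      HasH (fun y : EuclideanSpace ℝ (Fin n) => (‖y‖ ^ 2) ^ (-p)) x H ∧
      tr2 (a x) H = (‖x‖ ^ 2) ^ (-p - 1) * (2 * p) *
        (2 * (p + 1) * (QF (a x) x / ‖x‖ ^ 2) - (a x).trace) := fun x => by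
    by_cases hx : 0 < ‖x‖ ^ 2
    · obtain ⟨H, hH⟩ := h.tr2_radial (p := p) hx
      exact ⟨H, fun _ => hH⟩
    · exact ⟨0, fun hh => absurd hh hx⟩
  choose Hb hHb using hex
  refine ⟨Hb, p * (n - ζ), mul_pos hp0 (by linarith), ?_⟩
  have hω := (tendsto_order.mp (tendsto_omega (half_pos h.hε) ((ζ + n) * C))).2 ((n - ζ) / 2)
    (by linarith)
  filter_upwards [tendsto_nsq.eventually hω, tendsto_nsq.eventually_gt_atTop 0] with x h1 hx
  obtain ⟨hH, hL⟩ := hHb x hx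
  refine ⟨cont_pow hx, hH, Real.rpow_pos_of_pos hx _, ?_⟩
  rw [hL]
  obtain ⟨A, t, hA, ht, a1, a2, t1, t2⟩ := h.trQF hx
  rw [hA, ht, mul_div_cancel_right₀ _ hx.ne', show -p - 1 = -(ζ / 2) by rw [hp]; ring,
    sq_rpow_neg (norm_nonneg _), show 2 * (p + 1) = ζ by rw [hp]; ring]
  have hz : 0 ≤ ‖x‖ ^ (-ζ) := by positivity
  have h2 : ζ * A - t ≤ - ((n - ζ) / 2) := by
    have := mul_le_mul_of_nonneg_left a2 (show 0 ≤ ζ by linarith)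
    linarith
  have h3 := mul_le_mul_of_nonneg_left h2 (mul_nonneg hz (show 0 ≤ 2 * p by linarith))
  linarith

lemma CoreHyp.barr_gt (h : CoreHyp n ζ ε C lam Lam Cf Rf a f v) (hζn : n < ζ) :
    ∃ δ, 0 < δ ∧ Barr ζ a (fun s => s ^ (-(((n:ℝ) - 2) / 2)) - s ^ (-(((n:ℝ) - 2) / 2 + δ))) := by
  have hε := h.hε
  have hC := h.hC
  have hn : (3:ℝ) ≤ n := by exact_mod_cast h.hn
  obtain ⟨δ, hδ, hδε, hδζ⟩ : ∃ δ : ℝ, 0 < δ ∧ δ < ε / 2 ∧ n + 2 * δ ≤ ζ := by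
    refine ⟨min (ε / 4) ((ζ - n) / 2), lt_min (by linarith) (by linarith), ?_, ?_⟩
    · exact lt_of_le_of_lt (min_le_left _ _) (by linarith)
    · have := min_le_right (ε / 4) ((ζ - n) / 2); linarith
  refine ⟨δ, hδ, ?_⟩
  set p := ((n:ℝ) - 2) / 2 with hp
  have hp0 : 0 < p := by rw [hp]; linarith
  have hex : ∀ x : EuclideanSpace ℝ (Fin n), ∃ H : Matrix (Fin n) (Fin n) ℝ, 0 < ‖x‖ ^ 2 →
      HasH (fun y : EuclideanSpace ℝ (Fin n) => (‖y‖ ^ 2) ^ (-p) - (‖y‖ ^ 2) ^ (-(p + δ))) x H ∧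
      tr2 (a x) H = (‖x‖ ^ 2) ^ (-p - 1) * (2 * p) *
        (2 * (p + 1) * (QF (a x) x / ‖x‖ ^ 2) - (a x).trace) -
        (‖x‖ ^ 2) ^ (-(p + δ) - 1) * (2 * (p + δ)) *
        (2 * (p + δ + 1) * (QF (a x) x / ‖x‖ ^ 2) - (a x).trace) := fun x => by
    by_cases hx : 0 < ‖x‖ ^ 2
    · obtain ⟨H, hH, hL⟩ := h.tr2_radial (p := p) hx
      obtain ⟨H', hH', hL'⟩ := h.tr2_radial (p := p + δ) hx
      exact ⟨H - H', fun _ => ⟨hH.sub hH', by rw [tr2_sub, hL, hL']⟩⟩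
    · exact ⟨0, fun hh => absurd hh hx⟩
  choose Hb hHb using hex
  refine ⟨Hb, (p + δ) * δ, by positivity, ?_⟩
  have w1 := (tendsto_order.mp (tendsto_omega (e := ε / 2 - δ) (by linarith) (4 * p * n * C))).2
    ((p + δ) * δ) (by positivity)
  have w2 := (tendsto_order.mp (tendsto_omega (half_pos hε) ((2 * n + 2 * δ) * C))).2 δ hδ
  filter_upwards [tendsto_nsq.eventually w1, tendsto_nsq.eventually w2,
    tendsto_nsq.eventually_gt_atTop 1] with x h1 h2 hx1
  have hx : 0 < ‖x‖ ^ 2 := by linarith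
  obtain ⟨hH, hL⟩ := hHb x hx
  refine ⟨(cont_pow hx).sub (cont_pow hx), hH, ?_, ?_⟩
  · rw [sub_pos]
    exact Real.rpow_lt_rpow_of_exponent_lt hx1 (by linarith)
  rw [hL]
  obtain ⟨A, t, hA, ht, a1, a2, t1, t2⟩ := h.trQF hx
  rw [hA, ht, mul_div_cancel_right₀ _ hx.ne']
  have e2 : 2 * (p + 1) = n := by rw [hp]; ring
  have e3 : 2 * (p + δ + 1) = n + 2 * δ := by rw [hp]; ring
  have e4 : (‖x‖ ^ 2) ^ (-p - 1) * (‖x‖ ^ 2) ^ (-(ε / 2)) =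
      (‖x‖ ^ 2) ^ (-(p + δ) - 1) * (‖x‖ ^ 2) ^ (-(ε / 2 - δ)) := by
    rw [← Real.rpow_add hx, ← Real.rpow_add hx]; congr 1; ring
  have e5 : ‖x‖ ^ (-ζ) ≤ (‖x‖ ^ 2) ^ (-(p + δ) - 1) := by
    rw [← sq_rpow_neg (norm_nonneg _)]
    exact Real.rpow_le_rpow_of_exponent_le hx1.le (by rw [hp]; linarith)
  rw [e2, e3]
  set ω := C * (‖x‖ ^ 2) ^ (-(ε / 2)) with hω
  set U := (‖x‖ ^ 2) ^ (-p - 1) with hU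
  set W := (‖x‖ ^ 2) ^ (-(p + δ) - 1) with hW
  set τ := (‖x‖ ^ 2) ^ (-(ε / 2 - δ)) with hτ
  have hU0 : 0 < U := Real.rpow_pos_of_pos hx _
  have hW0 : 0 < W := Real.rpow_pos_of_pos hx _
  have hUW : U * ω = W * (C * τ) := by rw [hω]; linear_combination C * e4
  have f1 : n * A - t ≤ 2 * n * ω := by
    have := mul_le_mul_of_nonneg_left a2 (show 0 ≤ (n:ℝ) by linarith)
    linarith
  have f2 : δ ≤ (n + 2 * δ) * A - t := by
    have := mul_le_mul_of_nonneg_left a1 (show 0 ≤ (n:ℝ) + 2 * δ by linarith)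
    linarith
  have g1 := mul_le_mul_of_nonneg_left f1 (show 0 ≤ U * (2 * p) by positivity)
  have g2 := mul_le_mul_of_nonneg_left f2 (show 0 ≤ W * (2 * (p + δ)) by positivity)
  have g3 : U * (2 * p) * (2 * n * ω) = W * (4 * p * n * C * τ) := by
    linear_combination 4 * p * n * hUW
  have g4 := mul_le_mul_of_nonneg_left h1.le hW0.le
  have g5 := mul_le_mul_of_nonneg_left e5 (show 0 ≤ (p + δ) * δ by positivity)
  linarith

lemma CoreHyp.barr_eq (h : CoreHyp n ζ ε C lam Lam Cf Rf a f v) (hζn : ζ = n) :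
    Barr ζ a (fun s => s ^ (-(((n:ℝ) - 2) / 2)) * Real.log s) := by
  have hε := h.hε
  have hC := h.hC
  have hn : (3:ℝ) ≤ n := by exact_mod_cast h.hn
  set p := ((n:ℝ) - 2) / 2 with hp
  have hp0 : 0 < p := by rw [hp]; linarith
  have hd : ∀ (r s : ℝ), 0 < s → HasDerivAt (fun s => s ^ r) (r * s ^ (r - 1)) s := by
    intro r s hs
    simpa using (hasDerivAt_id s).rpow_const (p := r) (Or.inl hs.ne')
  have hd1 : ∀ s : ℝ, 0 < s → HasDerivAt (fun s => s ^ (-p) * Real.log s)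
      (s ^ (-p - 1) * (1 - p * Real.log s)) s := fun s hs => by
    refine ((hd (-p) s hs).mul (Real.hasDerivAt_log hs.ne')).congr_deriv ?_
    have e1 : s ^ (-p) = s ^ (-p - 1) * s := by
      rw [← Real.rpow_add_one hs.ne']; congr 1; ring
    rw [e1]; field_simp; ring
  have hd2 : ∀ s : ℝ, 0 < s → HasDerivAt (fun s => s ^ (-p - 1) * (1 - p * Real.log s))
      (s ^ (-p - 2) * (p * (p + 1) * Real.log s - (2 * p + 1))) s := fun s hs => by
    refine ((hd (-p - 1) s hs).mul
      (((Real.hasDerivAt_log hs.ne').const_mul p).const_sub 1)).congr_deriv ?_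
    have e1 : s ^ (-p - 1) = s ^ (-p - 2) * s := by
      rw [← Real.rpow_add_one hs.ne']; congr 1; ring
    rw [e1, show -p - 1 - 1 = -p - 2 by ring]; field_simp; ring
  have hHb : ∀ x : EuclideanSpace ℝ (Fin n), 0 < ‖x‖ ^ 2 →
      HasH (fun y : EuclideanSpace ℝ (Fin n) => (‖y‖ ^ 2) ^ (-p) * Real.log (‖y‖ ^ 2)) x
      ((2 * ((‖x‖ ^ 2) ^ (-p - 1) * (1 - p * Real.log (‖x‖ ^ 2)))) • (1 : Matrix (Fin n) (Fin n) ℝ)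
        + (4 * ((‖x‖ ^ 2) ^ (-p - 2) * (p * (p + 1) * Real.log (‖x‖ ^ 2) - (2 * p + 1)))) • vv x) := by
    intro x hx
    have := hasH_radial (F := fun s => s ^ (-p) * Real.log s)
      (F1 := fun s => s ^ (-p - 1) * (1 - p * Real.log s)) (x := x) (x0 := 0) (by
        rw [sub_zero]
        filter_upwards [lt_mem_nhds hx] with s hs using hd1 s hs) (hd2 _ (by simpa using hx))
    simpa only [sub_zero] using this
  refine ⟨fun x => ((2 * ((‖x‖ ^ 2) ^ (-p - 1) * (1 - p * Real.log (‖x‖ ^ 2)))) •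
    (1 : Matrix (Fin n) (Fin n) ℝ)
      + (4 * ((‖x‖ ^ 2) ^ (-p - 2) * (p * (p + 1) * Real.log (‖x‖ ^ 2) - (2 * p + 1)))) • vv x),
    (n - 2), by linarith, ?_⟩
  have w1 : Tendsto (fun s : ℝ => 4 * p * n * C * (Real.log s / s ^ (ε / 2))) atTop (𝓝 0) := by
    simpa using ((isLittleO_log_rpow_atTop (half_pos hε)).tendsto_div_nhds_zero).const_mul (4 * p * n * C)
  have w1' := (tendsto_order.mp w1).2 ((n - 2) / 2) (by linarith)
  have w2 := (tendsto_order.mp (tendsto_omega (half_pos hε) (6 * n * C))).2 ((n - 2) / 2) (by linarith)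
  filter_upwards [tendsto_nsq.eventually w1', tendsto_nsq.eventually w2,
    tendsto_nsq.eventually_gt_atTop 1] with x h1 h2 hx1
  have hx : 0 < ‖x‖ ^ 2 := by linarith
  refine ⟨(cont_pow hx).mul (ContinuousAt.log (by fun_prop) hx.ne'), hHb x hx,
    mul_pos (Real.rpow_pos_of_pos hx _) (Real.log_pos hx1), ?_⟩
  rw [tr2_pow]
  obtain ⟨A, t, hA, ht, a1, a2, t1, t2⟩ := h.trQF hx
  have e0 : ‖x‖ ^ (-ζ) = (‖x‖ ^ 2) ^ (-p - 1) := by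
    rw [← sq_rpow_neg (norm_nonneg _)]; congr 1; rw [hp, hζn]; ring
  have e1 : (‖x‖ ^ 2) ^ (-p - 1) = (‖x‖ ^ 2) ^ (-p - 2) * ‖x‖ ^ 2 := by
    rw [← Real.rpow_add_one hx.ne']; congr 1; ring
  have e3 : Real.log (‖x‖ ^ 2) / (‖x‖ ^ 2) ^ (ε / 2) =
      Real.log (‖x‖ ^ 2) * (‖x‖ ^ 2) ^ (-(ε / 2)) := by
    rw [Real.rpow_neg hx.le, div_eq_mul_inv]
  rw [e3] at h1
  have hU0 : 0 < (‖x‖ ^ 2) ^ (-p - 1) := Real.rpow_pos_of_pos hx _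
  rw [hA, ht, e0]
  have hl := Real.log_pos hx1
  set l := Real.log (‖x‖ ^ 2) with hl'
  have e4 : 2 * ((‖x‖ ^ 2) ^ (-p - 1) * (1 - p * l)) * t
      + 4 * ((‖x‖ ^ 2) ^ (-p - 2) * (p * (p + 1) * l - (2 * p + 1))) * (A * ‖x‖ ^ 2) =
      (‖x‖ ^ 2) ^ (-p - 1) * (2 * p * l * (n * A - t) + 2 * t - 4 * (n - 1) * A) := by
    rw [e1, show (n:ℝ) = 2 * p + 2 by rw [hp]; ring]; ring
  rw [e4]
  set ω := C * (‖x‖ ^ 2) ^ (-(ε / 2)) with hω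
  have f1 : n * A - t ≤ 2 * n * ω := by
    have := mul_le_mul_of_nonneg_left a2 (show 0 ≤ (n:ℝ) by linarith)
    linarith
  have f2 := mul_le_mul_of_nonneg_left f1 (show 0 ≤ 2 * p * l by positivity)
  have f3 := mul_le_mul_of_nonneg_left a1 (show 0 ≤ 4 * ((n:ℝ) - 1) by linarith)
  have hω0 : 0 ≤ ω := by positivity
  have f4 : 2 * p * l * (2 * n * ω) ≤ (n - 2) / 2 := by
    rw [hω]; linarith
  have f5 : 6 * n * ω ≤ (n - 2) / 2 := by rw [hω]; linarith
  have f6 : 2 * p * l * (n * A - t) + 2 * t - 4 * (n - 1) * A ≤ - (n - 2) := by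
    nlinarith
  have := mul_le_mul_of_nonneg_left f6 hU0.le
  linarith

end rates

section change
variable {n : ℕ}

open scoped MatrixOrder Matrix.Norms.L2Operator in
lemma exists_factor {A : Matrix (Fin n) (Fin n) ℝ} (hA : A.PosDef) :
    ∃ M N : Matrix (Fin n) (Fin n) ℝ, M.transpose = M ∧ N.transpose = N ∧ M * M = A ∧
      M * N = 1 ∧ N * M = 1 := by
  set M := CFC.sqrt A with hM
  have h1 : M * M = A := CFC.sqrt_mul_sqrt_self _ hA.posSemidef.nonneg
  have h2 : M.transpose = M := by
    have : IsSelfAdjoint M := (CFC.sqrt_nonneg A).isSelfAdjoint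
    have h3 := this.star_eq
    rwa [Matrix.star_eq_conjTranspose, Matrix.conjTranspose_eq_transpose_of_trivial] at h3
  have h3 : IsUnit M.det := by
    have := hA.det_pos
    rw [← h1, Matrix.det_mul] at this
    exact isUnit_iff_ne_zero.mpr fun h0 => by simp [h0] at this
  exact ⟨M, M⁻¹, h2, by rw [Matrix.transpose_nonsing_inv, h2], h1, Matrix.mul_nonsing_inv _ h3,
    Matrix.nonsing_inv_mul _ h3⟩

noncomputable def cl (M : Matrix (Fin n) (Fin n) ℝ) :
    EuclideanSpace ℝ (Fin n) →L[ℝ] EuclideanSpace ℝ (Fin n) :=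
  Matrix.toEuclideanCLM (n := Fin n) (𝕜 := ℝ) M

lemma cl_apply (M : Matrix (Fin n) (Fin n) ℝ) (x : EuclideanSpace ℝ (Fin n)) (i : Fin n) :
    cl M x i = ∑ j, M i j * x j := rfl

lemma cl_mul (M N : Matrix (Fin n) (Fin n) ℝ) (x : EuclideanSpace ℝ (Fin n)) :
    cl (M * N) x = cl M (cl N x) := by simp [cl, map_mul]

lemma cl_one (x : EuclideanSpace ℝ (Fin n)) : cl 1 x = x := by simp [cl]

lemma QF_eq (H : Matrix (Fin n) (Fin n) ℝ) (p : EuclideanSpace ℝ (Fin n)) :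
    QF H p = inner ℝ p (cl H p) := by
  rw [cl, Matrix.inner_toEuclideanCLM]
  simp only [QF, dotProduct, Matrix.mulVec, Finset.mul_sum]
  refine Finset.sum_congr rfl fun i _ => Finset.sum_congr rfl fun j _ => by ring

lemma inner_cl {M : Matrix (Fin n) (Fin n) ℝ} (hM : M.transpose = M)
    (p q : EuclideanSpace ℝ (Fin n)) : inner ℝ p (cl M q) = inner ℝ (cl M p) q := by
  rw [real_inner_comm q, cl, Matrix.inner_toEuclideanCLM, Matrix.inner_toEuclideanCLM,
    Matrix.dotProduct_mulVec, dotProduct_comm, ← Matrix.mulVec_transpose, hM]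

lemma QF_conj {N : Matrix (Fin n) (Fin n) ℝ} (hN : N.transpose = N) (A : Matrix (Fin n) (Fin n) ℝ)
    (p : EuclideanSpace ℝ (Fin n)) : QF (N * A * N) p = QF A (cl N p) := by
  rw [QF_eq, QF_eq, cl_mul, cl_mul, inner_cl hN]

lemma tr2_eq (A H : Matrix (Fin n) (Fin n) ℝ) : tr2 A H = (A * H.transpose).trace := by
  simp [tr2, Matrix.trace, Matrix.mul_apply]

lemma tr2_conj {M N : Matrix (Fin n) (Fin n) ℝ} (hM : M.transpose = M)
    (hMN : M * N = 1) (hNM : N * M = 1) (A H : Matrix (Fin n) (Fin n) ℝ) :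
    tr2 (N * A * N) (M * H * M) = tr2 A H := by
  rw [tr2_eq, tr2_eq]
  simp only [Matrix.transpose_mul, hM]
  calc (N * A * N * (M * (H.transpose * M))).trace = (N * (A * (N * M) * H.transpose * M)).trace := by
        simp only [Matrix.mul_assoc]
    _ = _ := by
        rw [Matrix.trace_mul_comm, hNM]
        simp only [Matrix.mul_assoc, hMN, Matrix.mul_one]

lemma hess_comp {v : EuclideanSpace ℝ (Fin n) → ℝ} (hv : ContDiff ℝ 2 v)
    {M : Matrix (Fin n) (Fin n) ℝ} (hM : M.transpose = M) (s c : ℝ) (y : EuclideanSpace ℝ (Fin n)) :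
    hess (fun y => s * v (cl M y) + c) y = s • (M * hess v (cl M y) * M) := by
  have hv1 : Differentiable ℝ v := hv.differentiable (by norm_num)
  have hv2 : Differentiable ℝ (fderiv ℝ v) :=
    (hv.fderiv_right (m := 1) (by norm_num)).differentiable (by norm_num)
  have h1 : fderiv ℝ (fun y => s * v (cl M y) + c) =
      fun y => s • (fderiv ℝ v (cl M y)).comp (cl M) := by
    funext y
    exact ((((hv1 _).hasFDerivAt.comp y (cl M).hasFDerivAt).const_mul s).add_const c).fderiv
  have h2 : ∀ p q, fderiv ℝ (fun y => s • (fderiv ℝ v (cl M y)).comp (cl M)) y p q =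
      s * fderiv ℝ (fderiv ℝ v) (cl M y) (cl M p) (cl M q) := by
    intro p q
    have h3 : HasFDerivAt (fun y => fderiv ℝ v (cl M y))
        ((fderiv ℝ (fderiv ℝ v) (cl M y)).comp (cl M)) y :=
      (hv2 _).hasFDerivAt.comp y (cl M).hasFDerivAt
    have h3 := (h3.clm_comp (hasFDerivAt_const (cl M) y)).const_smul s
    erw [h3.fderiv]
    simp
  have he : ∀ i, cl M (EuclideanSpace.single i 1) = ∑ k, M i k • EuclideanSpace.single k (1:ℝ) := by
    intro i
    ext j
    have : M j i = M i j := congrFun (congrFun hM i) j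
    simp [cl_apply, Pi.single_apply, this]
  ext i j
  simp only [hess, Matrix.of_apply, iteratedFDeriv_two_apply, h1, h2, Matrix.smul_apply,
    Matrix.mul_apply, smul_eq_mul]
  congr 1
  simp only [Matrix.cons_val_zero, Matrix.cons_val_one, he]
  simp only [map_sum, map_smul, sum_apply, smul_apply, smul_eq_mul, Finset.mul_sum, Finset.sum_mul]
  refine Finset.sum_congr rfl fun k _ => Finset.sum_congr rfl fun l _ => ?_
  have : M k j = M j k := congrFun (congrFun hM j) k
  rw [this]; ring

end change

section final
variable {n : ℕ} {ζ ε C lam Lam Cf Rf : ℝ}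
  {a : EuclideanSpace ℝ (Fin n) → Matrix (Fin n) (Fin n) ℝ}
  {f v : EuclideanSpace ℝ (Fin n) → ℝ}

lemma CoreHyp.core (h : CoreHyp n ζ ε C lam Lam Cf Rf a f v) (hv0 : ∀ x, 0 ≤ v x) :
    ∃ vinf : ℝ,
      (ζ ≠ n → ∃ K R : ℝ, 0 < K ∧ 1 < R ∧ ∀ x : EuclideanSpace ℝ (Fin n), R ≤ ‖x‖ →
        |v x - vinf| ≤ K * ‖x‖ ^ ((2 : ℝ) - min (n : ℝ) ζ)) ∧
      (ζ = n → ∃ K R : ℝ, 0 < K ∧ 1 < R ∧ ∀ x : EuclideanSpace ℝ (Fin n), R ≤ ‖x‖ →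
        |v x - vinf| ≤ K * (‖x‖ ^ ((2 : ℝ) - n) * Real.log ‖x‖)) := by
  have hζ := h.hζ
  have hn : (3:ℝ) ≤ n := by exact_mod_cast h.hn
  obtain ⟨M, hM⟩ := h.bounded hv0
  have hM0 : 0 < M + 1 := by have := hv0 0; have := hM 0; linarith
  have hMa : ∀ x, |v x| ≤ M + 1 := fun x => by
    rw [abs_of_nonneg (hv0 x)]; have := hM x; linarith
  rcases lt_trichotomy ζ n with hc | hc | hc
  · obtain ⟨vinf, K, R, hK, hR, hb⟩ := h.finish hM0 hMa (h.barr_lt hc)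
      (tendsto_rpow_neg_atTop (by linarith))
    refine ⟨vinf, fun _ => ⟨K, R, hK, hR, fun x hx => ?_⟩, fun he => absurd he hc.ne⟩
    have := hb x hx
    simp only [sq_rpow_neg (norm_nonneg _)] at this
    rwa [min_eq_right hc.le, show 2 - ζ = -(ζ - 2) by ring]
  · have hp : 0 < ((n:ℝ) - 2) / 2 := by linarith
    obtain ⟨vinf, K, R, hK, hR, hb⟩ := h.finish hM0 hMa (h.barr_eq hc) (by
      refine ((isLittleO_log_rpow_atTop hp).tendsto_div_nhds_zero).congr' ?_
      filter_upwards [eventually_gt_atTop 0] with s hs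
      rw [Real.rpow_neg hs.le, div_eq_mul_inv, mul_comm])
    refine ⟨vinf, fun he => absurd hc he, fun _ => ⟨K * 2, R, by positivity, hR, fun x hx => ?_⟩⟩
    have := hb x hx
    simp only [sq_rpow_neg (norm_nonneg _), Real.log_pow] at this
    rw [show (2:ℝ) - n = -(n - 2) by ring]
    push_cast at this
    linarith
  · obtain ⟨δ, hδ, hB⟩ := h.barr_gt hc
    obtain ⟨vinf, K, R, hK, hR, hb⟩ := h.finish hM0 hMa hB (by
      simpa using (tendsto_rpow_neg_atTop (show 0 < ((n:ℝ) - 2) / 2 by linarith)).sub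
        (tendsto_rpow_neg_atTop (show 0 < ((n:ℝ) - 2) / 2 + δ by linarith)))
    refine ⟨vinf, fun _ => ⟨K, R, hK, hR, fun x hx => ?_⟩, fun he => absurd he hc.ne'⟩
    have := hb x hx
    simp only [sq_rpow_neg (norm_nonneg _)] at this
    rw [min_eq_left hc.le, show (2:ℝ) - n = -(n - 2) by ring]
    have h2 : 0 ≤ (‖x‖ ^ 2) ^ (-(((n:ℝ) - 2) / 2 + δ)) := by positivity
    have h3 := mul_nonneg hK.le h2
    linarith

lemma abs_QF_le {A : Matrix (Fin n) (Fin n) ℝ} {k : ℝ} (hk : ∀ i j, |A i j| ≤ k)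
    (p : EuclideanSpace ℝ (Fin n)) : |QF A p| ≤ n ^ 2 * k * ‖p‖ ^ 2 := by
  calc |QF A p| ≤ ∑ i, ∑ j, |A i j * p i * p j| :=
        (Finset.abs_sum_le_sum_abs _ _).trans
          (Finset.sum_le_sum fun i _ => Finset.abs_sum_le_sum_abs _ _)
    _ ≤ ∑ i : Fin n, ∑ j : Fin n, k * ‖p‖ ^ 2 := by
        refine Finset.sum_le_sum fun i _ => Finset.sum_le_sum fun j _ => ?_
        rw [abs_mul, abs_mul, mul_assoc]
        have h1 : |p i| ≤ ‖p‖ := PiLp.norm_apply_le p i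
        have h2 : |p j| ≤ ‖p‖ := PiLp.norm_apply_le p j
        have h3 : |p i| * |p j| ≤ ‖p‖ ^ 2 := by
          rw [pow_two]; exact mul_le_mul h1 h2 (abs_nonneg _) (norm_nonneg _)
        exact mul_le_mul (hk i j) h3 (by positivity) ((abs_nonneg _).trans (hk i j))
    _ = _ := by simp; ring

lemma exists_norm_bound {M N : Matrix (Fin n) (Fin n) ℝ} (hMN : M * N = 1) (hNM : N * M = 1) :
    ∃ L : ℝ, 1 ≤ L ∧ (∀ x, ‖cl M x‖ ≤ L * ‖x‖) ∧ (∀ x, ‖cl N x‖ ≤ L * ‖x‖) ∧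
      (∀ x, ‖x‖ ≤ L * ‖cl M x‖) ∧ (∀ x, ‖x‖ ≤ L * ‖cl N x‖) := by
  refine ⟨‖cl M‖ + ‖cl N‖ + 1, by have := norm_nonneg (cl M); have := norm_nonneg (cl N); linarith, ?_⟩
  have h1 : ∀ x, ‖cl M x‖ ≤ (‖cl M‖ + ‖cl N‖ + 1) * ‖x‖ := fun x =>
    ((cl M).le_opNorm x).trans (mul_le_mul_of_nonneg_right
      (by have := norm_nonneg (cl N); linarith) (norm_nonneg _))
  have h2 : ∀ x, ‖cl N x‖ ≤ (‖cl M‖ + ‖cl N‖ + 1) * ‖x‖ := fun x =>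
    ((cl N).le_opNorm x).trans (mul_le_mul_of_nonneg_right
      (by have := norm_nonneg (cl M); linarith) (norm_nonneg _))
  refine ⟨h1, h2, fun x => ?_, fun x => ?_⟩
  · have := h2 (cl M x)
    rwa [← cl_mul, hNM, cl_one] at this
  · have := h1 (cl N x)
    rwa [← cl_mul, hMN, cl_one] at this

lemma rpow_neg_le {L r t z : ℝ} (hL : 1 ≤ L) (hr : 0 < r) (h : r ≤ L * t) (hz : 0 ≤ z) :
    t ^ (-z) ≤ L ^ z * r ^ (-z) := by
  have ht : 0 < t := by
    by_contra hc
    push Not at hc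
    nlinarith
  have h1 : r ^ z ≤ L ^ z * t ^ z := by
    rw [← Real.mul_rpow (by linarith) ht.le]
    exact Real.rpow_le_rpow hr.le h hz
  have h2 : 0 < r ^ z := Real.rpow_pos_of_pos hr _
  have h3 : 0 < t ^ z := Real.rpow_pos_of_pos ht _
  rw [Real.rpow_neg ht.le, Real.rpow_neg hr.le, ← div_eq_mul_inv, le_div_iff₀ h2, inv_mul_le_iff₀ h3]
  linarith

lemma mkCore (hn : 3 ≤ n) (hζ : 2 < ζ) (hs : ∀ x, (a x).IsSymm) (hlam : 0 < lam) (hLam : lam ≤ Lam)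
    (hell : ∀ x p, lam * ‖p‖ ^ 2 ≤ QF (a x) p ∧ QF (a x) p ≤ Lam * ‖p‖ ^ 2)
    (hε : 0 < ε) (hC : 0 < C) {M N : Matrix (Fin n) (Fin n) ℝ}
    (hM : M.transpose = M) (hN : N.transpose = N) (hMN : M * N = 1) (hNM : N * M = 1)
    (hdec : ∀ x : EuclideanSpace ℝ (Fin n), x ≠ 0 → ∀ i j : Fin n,
        |a x i j - (M * M) i j| ≤ C * ‖x‖ ^ (-ε))
    (hfc : Continuous f) (hCf : 0 < Cf) (hRf : 0 < Rf)
    (hfd : ∀ x : EuclideanSpace ℝ (Fin n), Rf ≤ ‖x‖ → ‖x‖ ^ ζ * |f x| ≤ Cf)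
    (hv : ContDiff ℝ 2 v) (heq : ∀ x, tr2 (a x) (hess v x) = f x) {s : ℝ} (hs1 : |s| = 1) (c : ℝ) :
    ∃ C' lam' Lam' Cf' Rf', CoreHyp n ζ ε C' lam' Lam' Cf' Rf' (fun y => N * a (cl M y) * N)
      (fun y => s * f (cl M y)) (fun y => s * v (cl M y) + c) := by
  obtain ⟨L, hL, m1, m2, m3, m4⟩ := exists_norm_bound hMN hNM
  have hL0 : 0 < L := by linarith
  have hn0 : (0:ℝ) < n := by exact_mod_cast (by omega : 0 < n)
  have sqle : ∀ {r t : ℝ}, 0 ≤ r → r ≤ L * t → r ^ 2 ≤ L ^ 2 * t ^ 2 := fun hr h => by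
    rw [← mul_pow]; gcongr
  refine ⟨n ^ 2 * (C * L ^ ε) * L ^ 2, lam / L ^ 2, Lam * L ^ 2, L ^ ζ * Cf, L * Rf,
    { hn := hn, hζ := hζ, hε := hε, hC := by positivity, hlam := by positivity
      hLam := mul_pos (by linarith) (by positivity), hCf := by positivity, hRf := by positivity
      symm := fun y => ?_, lo := fun y p => ?_, hi := fun y p => ?_, near := fun y hy p => ?_
      fcont := ?_, fdecay := fun y hy => ?_, hv := ?_, heq := fun y => ?_ }⟩
  · have := hs (cl M y)
    rw [Matrix.IsSymm] at this ⊢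
    rw [Matrix.transpose_mul, Matrix.transpose_mul, hN, this, Matrix.mul_assoc]
  · rw [QF_conj hN]
    refine le_trans ?_ (hell _ _).1
    rw [div_mul_eq_mul_div, div_le_iff₀ (by positivity)]
    have := mul_le_mul_of_nonneg_left (sqle (norm_nonneg _) (m4 p)) hlam.le
    linarith
  · rw [QF_conj hN]
    refine (hell _ _).2.trans ?_
    have := mul_le_mul_of_nonneg_left (sqle (norm_nonneg _) (m2 p)) (show 0 ≤ Lam by linarith)
    linarith
  · have hy0 : 0 < ‖y‖ := norm_pos_iff.mpr hy
    have hx0 : cl M y ≠ 0 := by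
      intro h0
      have := m3 y
      rw [h0, norm_zero, mul_zero] at this
      linarith
    have e1 : ‖p‖ ^ 2 = QF (M * M) (cl N p) := by
      have : QF (M * 1 * M) (cl N p) = QF 1 (cl M (cl N p)) := QF_conj hM _ _
      rw [Matrix.mul_one, ← cl_mul, hMN, cl_one, QF_one] at this
      exact this.symm
    rw [QF_conj hN, e1, ← QF_sub, ← e1]
    have hk : ∀ i j, |(a (cl M y) - M * M) i j| ≤ C * L ^ ε * ‖y‖ ^ (-ε) := fun i j => by
      refine (hdec _ hx0 i j).trans ?_
      have := mul_le_mul_of_nonneg_left (rpow_neg_le hL hy0 (m3 y) hε.le) hC.le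
      linarith
    refine (abs_QF_le hk _).trans ?_
    have h2 := mul_le_mul_of_nonneg_left (sqle (norm_nonneg _) (m2 p))
      (show 0 ≤ (n:ℝ) ^ 2 * (C * L ^ ε * ‖y‖ ^ (-ε)) by positivity)
    linarith
  · exact (hfc.comp (cl M).continuous).const_mul s |>.congr fun _ => rfl
  · have h1 := m3 y
    have h2 : Rf ≤ ‖cl M y‖ := by
      have := hy.trans h1
      exact le_of_mul_le_mul_left this hL0
    rw [abs_mul, hs1, one_mul]
    have h3 := hfd _ h2
    have h4 : ‖y‖ ^ ζ ≤ L ^ ζ * ‖cl M y‖ ^ ζ := by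
      rw [← Real.mul_rpow hL0.le (norm_nonneg _)]
      exact Real.rpow_le_rpow (norm_nonneg _) h1 (by linarith)
    have h5 := mul_le_mul_of_nonneg_right h4 (abs_nonneg (f (cl M y)))
    have h6 := mul_le_mul_of_nonneg_left h3 (show 0 ≤ L ^ ζ by positivity)
    linarith
  · exact (contDiff_const.mul (hv.comp (cl M).contDiff)).add contDiff_const
  · rw [hess_comp hv hM, tr2_smul, tr2_conj hM hMN hNM, heq]

lemma main_aux (hn : 3 ≤ n) (hζ : 2 < ζ) {M N : Matrix (Fin n) (Fin n) ℝ}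
    (hMN : M * N = 1) (hNM : N * M = 1) {s c : ℝ} (hs1 : |s| = 1)
    {A : EuclideanSpace ℝ (Fin n) → Matrix (Fin n) (Fin n) ℝ}
    {g : EuclideanSpace ℝ (Fin n) → ℝ}
    (h : CoreHyp n ζ ε C lam Lam Cf Rf A g (fun y => s * v (cl M y) + c))
    (hv0 : ∀ x, 0 ≤ s * v x + c) :
    ∃ vinf : ℝ,
      (ζ ≠ n → ∃ C R : ℝ, 0 < C ∧ 1 < R ∧ ∀ x : EuclideanSpace ℝ (Fin n), R ≤ ‖x‖ →
        |v x - vinf| ≤ C * ‖x‖ ^ ((2 : ℝ) - min (n : ℝ) ζ)) ∧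
      (ζ = n → ∃ C R : ℝ, 0 < C ∧ 1 < R ∧ ∀ x : EuclideanSpace ℝ (Fin n), R ≤ ‖x‖ →
        |v x - vinf| ≤ C * ‖x‖ ^ ((2 : ℝ) - n) * Real.log ‖x‖) := by
  obtain ⟨L, hL, m1, m2, m3, m4⟩ := exists_norm_bound hMN hNM
  have hL0 : 0 < L := by linarith
  have hn0 : (3:ℝ) ≤ n := by exact_mod_cast hn
  obtain ⟨w, hw1, hw2⟩ := h.core fun y => hv0 _
  have hss : s * s = 1 := by rw [← abs_mul_abs_self, hs1, one_mul]
  have hvw : ∀ x, |v x - s * (w - c)| = |s * v (cl M (cl N x)) + c - w| := fun x => by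
    rw [← cl_mul, hMN, cl_one]
    have : s * v x + c - w = s * (v x - s * (w - c)) := by linear_combination (w - c) * hss
    rw [this, abs_mul, hs1, one_mul]
  refine ⟨s * (w - c), fun hne => ?_, fun he => ?_⟩
  · obtain ⟨K, R, hK, hR, hb⟩ := hw1 hne
    set z := min (n:ℝ) ζ - 2 with hz
    have hz0 : 0 ≤ z := by
      have : (2:ℝ) ≤ min (n:ℝ) ζ := le_min (by linarith) hζ.le
      linarith
    refine ⟨K * L ^ z, L * R, by positivity, by nlinarith, fun x hx => ?_⟩
    have hx0 : 0 < ‖x‖ := lt_of_lt_of_le (by positivity) hx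
    have h1 : R ≤ ‖cl N x‖ := le_of_mul_le_mul_left (hx.trans (m4 x)) hL0
    rw [hvw]
    refine (hb _ h1).trans ?_
    rw [show (2:ℝ) - min (n:ℝ) ζ = -z by rw [hz]; ring]
    have := mul_le_mul_of_nonneg_left (rpow_neg_le hL hx0 (m4 x) hz0) hK.le
    linarith
  · obtain ⟨K, R, hK, hR, hb⟩ := hw2 he
    set z := (n:ℝ) - 2 with hz
    have hz0 : 0 ≤ z := by linarith
    refine ⟨K * L ^ z * 2, L * R, by positivity, by nlinarith, fun x hx => ?_⟩
    have hx0 : 0 < ‖x‖ := lt_of_lt_of_le (by positivity) hx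
    have h1 : R ≤ ‖cl N x‖ := le_of_mul_le_mul_left (hx.trans (m4 x)) hL0
    have hLx : L ≤ ‖x‖ := by nlinarith
    have hy0 : 0 < ‖cl N x‖ := by linarith
    rw [hvw]
    refine (hb _ h1).trans ?_
    rw [show (2:ℝ) - n = -z by rw [hz]; ring]
    have h2 := rpow_neg_le hL hx0 (m4 x) hz0
    have h3 : Real.log ‖cl N x‖ ≤ 2 * Real.log ‖x‖ := by
      have e1 : Real.log ‖cl N x‖ ≤ Real.log (L * ‖x‖) := Real.log_le_log hy0 (m2 x)
      rw [Real.log_mul hL0.ne' hx0.ne'] at e1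
      have e2 := Real.log_le_log hL0 hLx
      linarith
    have h4 : 0 ≤ Real.log ‖cl N x‖ := Real.log_nonneg (by linarith)
    have h5 : ‖cl N x‖ ^ (-z) * Real.log ‖cl N x‖ ≤ (L ^ z * ‖x‖ ^ (-z)) * (2 * Real.log ‖x‖) :=
      mul_le_mul h2 h3 h4 (by positivity)
    have := mul_le_mul_of_nonneg_left h5 hK.le
    linarith

end final

/-- **Theorem 3.1**: if `v ∈ C²(ℝⁿ)`, `n ≥ 3`, solves `a_{ij}(x)D_{ij}v = f` where the
coefficients are symmetric, uniformly elliptic, globally `C^α`, converge to a positive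
definite matrix `a(∞)` at rate `|x|^{-ε₀}`, `f` is continuous with
`limsup_{|x|→∞}|x|^ζ|f| < ∞`, `ζ > 2`, and `v` is bounded from one side, then
`v(x) = v_∞ + O(|x|^{2-min{n,ζ}})` (`O(|x|^{2-n}ln|x|)` if `ζ = n`). -/
theorem linear_elliptic_asymptotics
    (n : ℕ) (hn : 3 ≤ n) (α ζ : ℝ) (hα₀ : 0 < α) (hα₁ : α < 1) (hζ : 2 < ζ)
    (a : EuclideanSpace ℝ (Fin n) → Matrix (Fin n) (Fin n) ℝ)
    (ha_symm : ∀ x, (a x).IsSymm)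
    (ha_ell : ∃ lam Lam : ℝ, 0 < lam ∧ lam ≤ Lam ∧
      ∀ (x ξ : EuclideanSpace ℝ (Fin n)),
        lam * ‖ξ‖ ^ 2 ≤ ∑ i, ∑ j, a x i j * ξ i * ξ j ∧
        ∑ i, ∑ j, a x i j * ξ i * ξ j ≤ Lam * ‖ξ‖ ^ 2)
    (ha_holder : ∃ C : ℝ, ∀ (x y : EuclideanSpace ℝ (Fin n)) (i j : Fin n),
      |a x i j - a y i j| ≤ C * ‖x - y‖ ^ α)
    (ainf : Matrix (Fin n) (Fin n) ℝ) (hainf : ainf.PosDef)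
    (ha_decay : ∃ ε₀ C₀ : ℝ, 0 < ε₀ ∧ 0 < C₀ ∧
      ∀ x : EuclideanSpace ℝ (Fin n), x ≠ 0 → ∀ i j : Fin n,
        |a x i j - ainf i j| ≤ C₀ * ‖x‖ ^ (-ε₀))
    (f : EuclideanSpace ℝ (Fin n) → ℝ) (hf_cont : Continuous f)
    (hf_decay : ∃ C R : ℝ, 0 < C ∧ 0 < R ∧
      ∀ x : EuclideanSpace ℝ (Fin n), R ≤ ‖x‖ → ‖x‖ ^ ζ * |f x| ≤ C)
    (v : EuclideanSpace ℝ (Fin n) → ℝ) (hv : ContDiff ℝ 2 v)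
    (heq : ∀ x, ∑ i, ∑ j, a x i j * hess v x i j = f x)
    (hbdd : BddAbove (Set.range v) ∨ BddBelow (Set.range v)) :
    ∃ vinf : ℝ,
      (ζ ≠ n → ∃ C R : ℝ, 0 < C ∧ 1 < R ∧ ∀ x : EuclideanSpace ℝ (Fin n), R ≤ ‖x‖ →
        |v x - vinf| ≤ C * ‖x‖ ^ ((2 : ℝ) - min (n : ℝ) ζ)) ∧
      (ζ = n → ∃ C R : ℝ, 0 < C ∧ 1 < R ∧ ∀ x : EuclideanSpace ℝ (Fin n), R ≤ ‖x‖ →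
        |v x - vinf| ≤ C * ‖x‖ ^ ((2 : ℝ) - n) * Real.log ‖x‖) := by
  obtain ⟨lam, Lam, hlam, hLam, hell⟩ := ha_ell
  obtain ⟨ε, C, hε, hC, hdec⟩ := ha_decay
  obtain ⟨Cf, Rf, hCf, hRf, hfd⟩ := hf_decay
  obtain ⟨M, N, hM, hN, hMM, hMN, hNM⟩ := exists_factor hainf
  obtain ⟨s, c, hs1, hv0⟩ : ∃ s c : ℝ, |s| = 1 ∧ ∀ x, 0 ≤ s * v x + c := by
    rcases hbdd with ⟨B, hB⟩ | ⟨B, hB⟩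
    · exact ⟨-1, B, by simp, fun x => by have := hB ⟨x, rfl⟩; linarith⟩
    · exact ⟨1, -B, by simp, fun x => by have := hB ⟨x, rfl⟩; linarith⟩
  rw [← hMM] at hdec
  obtain ⟨C', l', L', Cf', Rf', h⟩ := mkCore hn hζ ha_symm hlam hLam hell hε hC hM hN hMN hNM hdec
    hf_cont hCf hRf hfd hv heq hs1 c
  exact main_aux hn hζ hMN hNM hs1 h hv0
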